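/- arXiv:math/0305313 — 2 statements merged into one kernel-verified Lean document; each statement's English description precedes it below -/
import Mathlib

section
/- (Dyadic level inequality for invariant measures) If μ is a CCF-invariant probability measure on Ω₁, then for every n ≥ 1, ∫_{Ω₁} ( #{i : pᵢ ∈ (2^{−n−1}, 2^{−n}]} ) · ( Σⱼ pⱼ·1{pⱼ > 2^{−n−1}} ) dμ(p) ≤ 4. -/
open MeasureTheory ENNReal Filter Set

noncomputable section

/-- The nonincreasing rearrangement of a nonnegative summable sequence:
`dRearrange x n` is the `(n+1)`-th largest value of `x` (zeros being ignored
when there are infinitely many positive entries). -/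
def dRearrange (x : ℕ → ℝ) (n : ℕ) : ℝ :=
  sInf {t : ℝ | {i | t < x i}.Finite ∧ Nat.card {i | t < x i} ≤ n}

/-- The space `Ω₁` of ordered partitions of `[0,1]`:
nonincreasing nonnegative sequences of sum `1`. -/
def Omega1 : Set (ℕ → ℝ) :=
  {p | (∀ i, 0 ≤ p i) ∧ Antitone p ∧ ∑' i, p i = 1}

/-- Result of merging parts `i` and `j` of `p`, rearranged nonincreasingly. -/
def mergeSeq (p : ℕ → ℝ) (i j : ℕ) : ℕ → ℝ :=
  dRearrange (fun m => if m = i then p i + p j else if m = j then 0 else p m)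

/-- Result of splitting part `i` of `p` into `u * p i` and `(1 - u) * p i`,
rearranged nonincreasingly. -/
def splitSeq (p : ℕ → ℝ) (i : ℕ) (u : ℝ) : ℕ → ℝ :=
  dRearrange (fun m =>
    if m = 0 then u * p i else if m = 1 then (1 - u) * p i
    else if m - 2 = i then 0 else p (m - 2))

/-- One-step transition kernel of the continuous coagulation-fragmentation (CCF)
chain: `CCFstep p A` is the probability that, starting from `p`, the next state
lies in `A`.  Two parts are size-biased sampled with replacement (part `i` has
probability `p i` at each draw); two distinct sampled parts are merged, while a
twice-sampled part is split by an independent uniform `u ∈ [0,1]`; the result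
is rearranged nonincreasingly. -/
def CCFstep (p : ℕ → ℝ) (A : Set (ℕ → ℝ)) : ℝ≥0∞ :=
  ∑' i : ℕ, ∑' j : ℕ,
    if i ≠ j then
      ENNReal.ofReal (p i * p j) * A.indicator (fun _ => (1 : ℝ≥0∞)) (mergeSeq p i j)
    else
      ENNReal.ofReal (p i ^ 2) *
        ∫⁻ u in Set.Icc (0:ℝ) 1, A.indicator (fun _ => (1 : ℝ≥0∞)) (splitSeq p i u)

/-- A probability measure `μ` on `Ω₁` is CCF-invariant if it is a stationary
distribution of the CCF chain. -/
def CCFInvariant (μ : Measure (ℕ → ℝ)) : Prop :=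
  IsProbabilityMeasure μ ∧ μ Omega1 = 1 ∧
    ∀ A : Set (ℕ → ℝ), MeasurableSet A → ∫⁻ p, CCFstep p A ∂μ = μ A

/-- A level `t` satisfies the condition defining `dRearrange x n` exactly when no `n + 1` entries
of `x` exceed `t`. -/
lemma finite_and_card_le_iff_forall_finset (x : ℕ → ℝ) (n : ℕ) (t : ℝ) :
    ({i | t < x i}.Finite ∧ Nat.card {i | t < x i} ≤ n) ↔
      ∀ s : Finset ℕ, s.card = n + 1 → ∃ i ∈ s, x i ≤ t := by
  constructor
  · rintro ⟨hf, hc⟩ s hs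
    by_contra! h
    have h1 : (s : Set ℕ) ⊆ {i | t < x i} := fun i hi => h i hi
    have h2 := Nat.card_mono hf h1
    simp only [Nat.card_coe_set_eq, Set.ncard_coe_finset] at h2 hc
    omega
  · intro h
    by_contra hcon
    obtain ⟨s, hs, hcard⟩ : ∃ s : Finset ℕ, (s : Set ℕ) ⊆ {i | t < x i} ∧ s.card = n + 1 := by
      by_cases hf : {i | t < x i}.Finite
      · have hc : n + 1 ≤ hf.toFinset.card := by
          have : ¬ Nat.card {i | t < x i} ≤ n := fun hc => hcon ⟨hf, hc⟩
          rw [Nat.card_coe_set_eq, Set.ncard_eq_toFinset_card _ hf] at this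
          omega
        obtain ⟨s, hs, hcard⟩ := Finset.exists_subset_card_eq hc
        exact ⟨s, fun i hi => by simpa using hs hi, hcard⟩
      · exact Set.Infinite.exists_subset_card_eq hf (n + 1)
    obtain ⟨i, hi, hle⟩ := h s hcard
    exact absurd (hs hi) (not_lt.mpr hle)

lemma measurable_dRearrange : Measurable dRearrange := by
  refine measurable_pi_lambda _ fun n => ?_
  set T : (ℕ → ℝ) → Set ℝ := fun x =>
    {t : ℝ | {i | t < x i}.Finite ∧ Nat.card {i | t < x i} ≤ n} with hT
  have hup : ∀ x s t, s ≤ t → s ∈ T x → t ∈ T x := by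
    intro x s t hst hs
    simp only [hT, Set.mem_ofPred_eq, finite_and_card_le_iff_forall_finset] at hs ⊢
    exact fun F hF => (hs F hF).imp fun i hi => ⟨hi.1, hi.2.trans hst⟩
  have hmeas : ∀ t, MeasurableSet {x | t ∈ T x} := by
    intro t
    simp only [hT, Set.mem_ofPred_eq, finite_and_card_le_iff_forall_finset]
    measurability
  have hne : MeasurableSet {x | (T x).Nonempty} := by
    have : {x | (T x).Nonempty} = ⋃ k : ℕ, {x | (k : ℝ) ∈ T x} := by
      ext x
      simp only [Set.mem_ofPred_eq, Set.mem_iUnion]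
      refine ⟨fun ⟨t, ht⟩ => ?_, fun ⟨k, hk⟩ => ⟨_, hk⟩⟩
      obtain ⟨k, hk⟩ := exists_nat_ge t
      exact ⟨k, hup x t k hk ht⟩
    rw [this]
    exact MeasurableSet.iUnion fun k => hmeas k
  have hbdd : MeasurableSet {x | BddBelow (T x)} := by
    have : {x | BddBelow (T x)} = ⋃ k : ℕ, {x | -(k : ℝ) ∈ T x}ᶜ := by
      ext x
      simp only [Set.mem_ofPred_eq, Set.mem_iUnion, Set.mem_compl_iff]
      refine ⟨fun ⟨b, hb⟩ => ?_, fun ⟨k, hk⟩ => ⟨-k, fun t ht => ?_⟩⟩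
      · obtain ⟨k, hk⟩ := exists_nat_gt (-b)
        exact ⟨k, fun h => by linarith [hb h]⟩
      · by_contra! hlt
        exact hk (hup x t _ hlt.le ht)
    rw [this]
    exact MeasurableSet.iUnion fun k => (hmeas _).compl
  refine measurable_of_Iio fun c => ?_
  have hset : (fun x => dRearrange x n) ⁻¹' Set.Iio c =
      ({x | (T x).Nonempty} ∩ {x | BddBelow (T x)} ∩
        ⋃ q : ℚ, {x | (q : ℝ) ∈ T x ∧ (q : ℝ) < c}) ∪
      (({x | (T x).Nonempty} ∩ {x | BddBelow (T x)})ᶜ ∩ {_x | 0 < c}) := by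
    ext x
    change sInf (T x) < c ↔ _
    by_cases h1 : (T x).Nonempty
    · by_cases h2 : BddBelow (T x)
      · simp only [Set.mem_union, Set.mem_inter_iff, Set.mem_ofPred_eq, h1, h2, Set.mem_iUnion,
          Set.mem_compl_iff, true_and, not_true_eq_false, false_and, or_false]
        rw [csInf_lt_iff h2 h1]
        refine ⟨fun ⟨t, ht, htc⟩ => ?_, fun ⟨q, hq, hqc⟩ => ⟨q, hq, hqc⟩⟩
        obtain ⟨q, hq1, hq2⟩ := exists_rat_btwn htc
        exact ⟨q, hup x t q hq1.le ht, hq2⟩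
      · simp [h2]
    · have h0 : T x = ∅ := Set.not_nonempty_iff_eq_empty.mp h1
      simp [h0]
  rw [hset]
  refine ((hne.inter hbdd).inter (MeasurableSet.iUnion fun q => ?_)).union
    ((hne.inter hbdd).compl.inter (MeasurableSet.const _))
  exact (hmeas q).inter (MeasurableSet.const _)

/-- Rearranging a bounded sequence does not decrease the sum of a monotone function of its
entries. -/
lemma tsum_le_tsum_dRearrange {x : ℕ → ℝ} (hx : BddAbove (Set.range x)) {g : ℝ → ℝ≥0∞}
    (hg : Monotone g) : ∑' i, g (x i) ≤ ∑' k, g (dRearrange x k) := by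
  have key : ∀ n : ℕ, ∀ s : Finset ℕ, s.card = n →
      ∑ i ∈ s, g (x i) ≤ ∑ k ∈ Finset.range n, g (dRearrange x k) := by
    intro n
    induction n with
    | zero => intro s hs; simp [Finset.card_eq_zero.mp hs]
    | succ n ih =>
      intro s hs
      obtain ⟨m, hm, hmin⟩ := s.exists_min_image x (Finset.card_pos.mp (by omega))
      rw [Finset.sum_range_succ, ← Finset.sum_erase_add _ _ hm]
      refine add_le_add (ih _ (by rw [Finset.card_erase_of_mem hm]; omega)) (hg ?_)
      refine le_csInf ?_ fun t ht => ?_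
      · obtain ⟨B, hB⟩ := hx
        refine ⟨B, (finite_and_card_le_iff_forall_finset x n B).mpr fun F hF => ?_⟩
        obtain ⟨i, hi⟩ := Finset.card_pos.mp (show 0 < F.card by omega)
        exact ⟨i, hi, hB ⟨i, rfl⟩⟩
      · obtain ⟨i, hi, hle⟩ := (finite_and_card_le_iff_forall_finset x n t).mp ht s hs
        exact (hmin i hi).trans hle
  rw [ENNReal.tsum_eq_iSup_sum]
  exact iSup_le fun s => (key _ s rfl).trans (ENNReal.sum_le_tsum _)

lemma measurable_mergeSeq (i j : ℕ) : Measurable fun p => mergeSeq p i j := by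
  refine measurable_dRearrange.comp (measurable_pi_lambda _ fun m => ?_)
  split_ifs <;> fun_prop

lemma measurable_splitSeq (i : ℕ) : Measurable fun q : (ℕ → ℝ) × ℝ => splitSeq q.1 i q.2 := by
  refine measurable_dRearrange.comp (measurable_pi_lambda _ fun m => ?_)
  split_ifs <;> fun_prop

lemma measurable_splitSeq_right (p : ℕ → ℝ) (i : ℕ) : Measurable (splitSeq p i) := by
  refine measurable_dRearrange.comp (measurable_pi_lambda _ fun m => ?_)
  split_ifs <;> fun_prop

lemma measurable_CCFstep {A : Set (ℕ → ℝ)} (hA : MeasurableSet A) :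
    Measurable fun p => CCFstep p A := by
  have hf : Measurable (A.indicator fun _ => (1 : ℝ≥0∞)) := measurable_const.indicator hA
  refine Measurable.tsum fun i => Measurable.tsum fun j => ?_
  split_ifs
  · exact (by fun_prop : Measurable fun p : ℕ → ℝ => ENNReal.ofReal (p i * p j)).mul
      (hf.comp (measurable_mergeSeq i j))
  · exact (by fun_prop : Measurable fun p : ℕ → ℝ => ENNReal.ofReal (p i ^ 2)).mul
      (hf.comp (measurable_splitSeq i)).lintegral_prod_right'

/-- The law of the next state of the CCF chain started from `p`. -/
def CCFlaw (p : ℕ → ℝ) : Measure (ℕ → ℝ) :=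
  Measure.sum fun i : ℕ => Measure.sum fun j : ℕ =>
    if i ≠ j then ENNReal.ofReal (p i * p j) • Measure.dirac (mergeSeq p i j)
    else ENNReal.ofReal (p i ^ 2) • (volume.restrict (Set.Icc (0:ℝ) 1)).map (splitSeq p i)

lemma lintegral_CCFlaw (p : ℕ → ℝ) {f : (ℕ → ℝ) → ℝ≥0∞} (hf : Measurable f) :
    ∫⁻ q, f q ∂CCFlaw p = ∑' i : ℕ, ∑' j : ℕ,
      if i ≠ j then ENNReal.ofReal (p i * p j) * f (mergeSeq p i j)
      else ENNReal.ofReal (p i ^ 2) * ∫⁻ u in Set.Icc (0:ℝ) 1, f (splitSeq p i u) := by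
  simp only [CCFlaw, lintegral_sum_measure]
  refine tsum_congr fun i => tsum_congr fun j => ?_
  split_ifs
  · rw [lintegral_smul_measure, lintegral_dirac' _ hf, smul_eq_mul]
  · rw [lintegral_smul_measure, lintegral_map hf (measurable_splitSeq_right p i), smul_eq_mul]

lemma CCFlaw_apply (p : ℕ → ℝ) {A : Set (ℕ → ℝ)} (hA : MeasurableSet A) :
    CCFlaw p A = CCFstep p A := by
  rw [← lintegral_indicator_one hA]
  exact lintegral_CCFlaw p (measurable_one.indicator hA)

lemma measurable_CCFlaw : Measurable CCFlaw := by
  refine Measure.measurable_of_measurable_coe _ fun A hA => ?_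
  simp only [CCFlaw_apply _ hA]
  exact measurable_CCFstep hA

lemma CCFInvariant.lintegral_lintegral {μ : Measure (ℕ → ℝ)} (hμ : CCFInvariant μ)
    {f : (ℕ → ℝ) → ℝ≥0∞} (hf : Measurable f) :
    ∫⁻ p, ∫⁻ q, f q ∂CCFlaw p ∂μ = ∫⁻ p, f p ∂μ := by
  have hbind : μ.bind CCFlaw = μ := by
    ext A hA
    rw [Measure.bind_apply hA measurable_CCFlaw.aemeasurable]
    simp only [CCFlaw_apply _ hA]
    exact hμ.2.2 A hA
  rw [← Measure.lintegral_bind measurable_CCFlaw.aemeasurable hf.aemeasurable, hbind]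

lemma summable_of_mem_Omega1 {p : ℕ → ℝ} (hp : p ∈ Omega1) : Summable p := by
  by_contra h
  have h1 := hp.2.2
  rw [tsum_eq_zero_of_not_summable h] at h1
  exact zero_ne_one h1

lemma tsum_ofReal_of_mem_Omega1 {p : ℕ → ℝ} (hp : p ∈ Omega1) :
    ∑' i, ENNReal.ofReal (p i) = 1 := by
  rw [← ENNReal.ofReal_tsum_of_nonneg hp.1 (summable_of_mem_Omega1 hp), hp.2.2,
    ENNReal.ofReal_one]

lemma measurableSet_Omega1 : MeasurableSet Omega1 := by
  have : Omega1 = {p : ℕ → ℝ | ∀ i, 0 ≤ p i} ∩ {p | ∀ i, p (i + 1) ≤ p i} ∩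
      {p | ∑' i, ENNReal.ofReal (p i) = 1} := by
    ext p
    refine ⟨fun hp => ⟨⟨hp.1, fun i => hp.2.1 i.le_succ⟩, tsum_ofReal_of_mem_Omega1 hp⟩,
      fun ⟨⟨h0, h1⟩, h2⟩ => ⟨h0, antitone_nat_of_succ_le h1, ?_⟩⟩
    have h3 := congrArg ENNReal.toReal (show ∑' i, ENNReal.ofReal (p i) = 1 from h2)
    rw [ENNReal.tsum_toReal_eq fun i => ENNReal.ofReal_ne_top] at h3
    simpa [ENNReal.toReal_ofReal (h0 _)] using h3
  rw [this]
  refine MeasurableSet.inter (MeasurableSet.inter ?_ ?_) ?_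
  · exact measurableSet_setOfPred.mpr (Measurable.forall fun i => measurableSet_setOfPred.mp
      (measurableSet_le measurable_const (measurable_pi_apply i)))
  · exact measurableSet_setOfPred.mpr (Measurable.forall fun i => measurableSet_setOfPred.mp
      (measurableSet_le (measurable_pi_apply _) (measurable_pi_apply i)))
  · exact measurableSet_eq_fun (Measurable.tsum fun i => by fun_prop) measurable_const

lemma le_one_of_mem_Omega1 {p : ℕ → ℝ} (hp : p ∈ Omega1) (i : ℕ) : p i ≤ 1 :=
  hp.2.2 ▸ (summable_of_mem_Omega1 hp).le_tsum i fun j _ => hp.1 j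

/-- The mass of a part of size `t`, counted only if it exceeds `a`. -/
def massAbove (a t : ℝ) : ℝ≥0∞ := ENNReal.ofReal (if a < t then t else 0)

/-- The mass of a part of size `t`, counted only if it lies in `(a/2, a]`. -/
def massAtLevel (a t : ℝ) : ℝ≥0∞ := ENNReal.ofReal (if a / 2 < t ∧ t ≤ a then t else 0)

/-- The indicator that a part of size `t` exceeds `a/2`. -/
def aboveHalf (a t : ℝ) : ℝ≥0∞ := ENNReal.ofReal (if a / 2 < t then 1 else 0)

lemma measurable_massAbove (a : ℝ) : Measurable (massAbove a) :=
  ENNReal.measurable_ofReal.comp (Measurable.ite measurableSet_Ioi measurable_id measurable_const)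

lemma massAbove_ne_top (a t : ℝ) : massAbove a t ≠ ∞ := ENNReal.ofReal_ne_top

lemma monotone_massAbove {a : ℝ} (ha : 0 < a) : Monotone (massAbove a) := by
  intro s t hst
  refine ENNReal.ofReal_le_ofReal ?_
  split_ifs <;> linarith

lemma massAbove_zero (a : ℝ) : massAbove a 0 = 0 := by
  simp [massAbove]

lemma massAbove_add_le {a x y : ℝ} (hx : 0 ≤ x) (hy : 0 ≤ y) :
    massAbove a x + massAbove a y +
      (massAtLevel a x * aboveHalf a y + massAtLevel a y * aboveHalf a x) ≤
    massAbove a (x + y) := by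
  unfold massAbove massAtLevel aboveHalf
  have h1 : ∀ P : Prop, [Decidable P] → ∀ z : ℝ, 0 ≤ z → 0 ≤ if P then z else 0 := by
    intro P _ z hz; split_ifs <;> simp [hz]
  rw [← ENNReal.ofReal_mul (h1 _ _ hx), ← ENNReal.ofReal_mul (h1 _ _ hy),
    ← ENNReal.ofReal_add (h1 _ _ hx) (h1 _ _ hy),
    ← ENNReal.ofReal_add (mul_nonneg (h1 _ _ hx) (h1 _ _ zero_le_one))
      (mul_nonneg (h1 _ _ hy) (h1 _ _ zero_le_one)),
    ← ENNReal.ofReal_add (add_nonneg (h1 _ _ hx) (h1 _ _ hy))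
      (add_nonneg (mul_nonneg (h1 _ _ hx) (h1 _ _ zero_le_one))
        (mul_nonneg (h1 _ _ hy) (h1 _ _ zero_le_one)))]
  refine ENNReal.ofReal_le_ofReal ?_
  split_ifs <;> grind

lemma tsum_eq_add_tsum_ite_ne {f : ℕ → ℝ≥0∞} (b : ℕ) :
    ∑' k, f k = f b + ∑' k, if k = b then 0 else f k := by
  convert ENNReal.tsum_eq_add_tsum_ite b

lemma tsum_massAbove_le_mergeSeq {a : ℝ} (ha : 0 < a) {p : ℕ → ℝ} (hp : p ∈ Omega1) {i j : ℕ}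
    (hij : i ≠ j) :
    ∑' k, massAbove a (p k) +
      (massAtLevel a (p i) * aboveHalf a (p j) + massAtLevel a (p j) * aboveHalf a (p i)) ≤
    ∑' k, massAbove a (mergeSeq p i j k) := by
  set x : ℕ → ℝ := fun m => if m = i then p i + p j else if m = j then 0 else p m with hx
  have hbdd : BddAbove (Set.range x) := by
    refine ⟨2, ?_⟩
    rintro _ ⟨m, rfl⟩
    have h1 := le_one_of_mem_Omega1 hp
    simp only [hx]
    split_ifs
    · linarith [h1 i, h1 j]
    · norm_num
    · linarith [h1 m]
  have hle := tsum_le_tsum_dRearrange hbdd (monotone_massAbove ha)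
  set R := ∑' m, if m = j then 0 else if m = i then 0 else massAbove a (p m)
  have hp_sum : ∑' k, massAbove a (p k) = massAbove a (p i) + (massAbove a (p j) + R) := by
    rw [tsum_eq_add_tsum_ite_ne i, tsum_eq_add_tsum_ite_ne j]
    simp [hij.symm, R]
  have hx_sum : ∑' k, massAbove a (x k) = massAbove a (p i + p j) + R := by
    rw [tsum_eq_add_tsum_ite_ne i]
    congr 1
    · simp [hx]
    · refine tsum_congr fun m => ?_
      by_cases h1 : m = i <;> by_cases h2 : m = j <;> simp [hx, h1, h2, massAbove_zero a, hij, hij.symm]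
  refine le_trans ?_ hle
  rw [hp_sum, hx_sum]
  refine le_trans (le_of_eq ?_) (add_le_add_left (massAbove_add_le (hp.1 i) (hp.1 j)) R)
  ring

lemma massAbove_le_split {a t : ℝ} (ha : 0 < a) (hat : a < t) {u : ℝ} (hu : u ∈ Set.Icc (0:ℝ) 1) :
    massAbove a t ≤ massAbove a (u * t) + massAbove a ((1 - u) * t) +
      ENNReal.ofReal a * ((Set.Iic (a / t)).indicator 1 u + (Set.Ici (1 - a / t)).indicator 1 u) := by
  have ht : 0 < t := ha.trans hat
  have e1 : u ≤ a / t ↔ u * t ≤ a := le_div_iff₀ ht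
  have e2 : 1 - a / t ≤ u ↔ (1 - u) * t ≤ a := by
    rw [← le_div_iff₀ ht]; constructor <;> intro h <;> linarith
  have h1 : 0 ≤ u * t := mul_nonneg hu.1 ht.le
  have h2 : 0 ≤ (1 - u) * t := mul_nonneg (by linarith [hu.2]) ht.le
  have h3 : u * t + (1 - u) * t = t := by ring
  have key : ∀ s : ℝ, 0 ≤ s → ENNReal.ofReal s ≤ massAbove a s +
      ENNReal.ofReal a * (if s ≤ a then 1 else 0) := by
    intro s hs
    unfold massAbove
    by_cases h : s ≤ a
    · simp [h, not_lt.mpr h, ENNReal.ofReal_le_ofReal h]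
    · simp [h, not_le.mp h]
  calc massAbove a t = ENNReal.ofReal (u * t) + ENNReal.ofReal ((1 - u) * t) := by
        rw [← ENNReal.ofReal_add h1 h2, h3, massAbove, if_pos hat]
    _ ≤ _ := add_le_add (key _ h1) (key _ h2)
    _ = _ := by
        simp only [Set.indicator_apply, Set.mem_Iic, Set.mem_Ici, e1, e2, Pi.one_apply]
        ring

lemma tsum_massAbove_add_le_splitSeq {a : ℝ} (ha : 0 < a) {p : ℕ → ℝ} (hp : p ∈ Omega1) (i : ℕ)
    {u : ℝ} (hu : u ∈ Set.Icc (0:ℝ) 1) :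
    ∑' k, massAbove a (p k) + (massAbove a (u * p i) + massAbove a ((1 - u) * p i)) ≤
    ∑' k, massAbove a (splitSeq p i u k) + massAbove a (p i) := by
  set x : ℕ → ℝ := fun m => if m = 0 then u * p i else if m = 1 then (1 - u) * p i
    else if m - 2 = i then 0 else p (m - 2) with hx
  have hbdd : BddAbove (Set.range x) := by
    refine ⟨1, ?_⟩
    rintro _ ⟨m, rfl⟩
    have h1 := le_one_of_mem_Omega1 hp
    have h0 := hp.1 i
    simp only [hx]
    split_ifs
    · nlinarith [h1 i, hu.1, hu.2]
    · nlinarith [h1 i, hu.1, hu.2]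
    · norm_num
    · exact h1 _
  have hle := tsum_le_tsum_dRearrange hbdd (monotone_massAbove ha)
  have hx_sum : ∑' k, massAbove a (x k) = massAbove a (u * p i) + massAbove a ((1 - u) * p i) +
      ∑' m, if m = i then 0 else massAbove a (p m) := by
    rw [← Summable.sum_add_tsum_nat_add' (k := 2) ENNReal.summable]
    congr 1
    · simp [Finset.sum_range_succ, hx]
    · refine tsum_congr fun m => ?_
      by_cases h : m = i <;> simp [hx, h, massAbove_zero a]
  rw [tsum_eq_add_tsum_ite_ne i]
  refine le_trans (le_of_eq ?_) (add_le_add_left hle _)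
  rw [hx_sum]
  ring

lemma lintegral_splitLoss_le {a t : ℝ} (ha : 0 < a) (hat : a < t) :
    ∫⁻ u in Set.Icc (0:ℝ) 1, ENNReal.ofReal a *
      ((Set.Iic (a / t)).indicator 1 u + (Set.Ici (1 - a / t)).indicator 1 u) ≤
    ENNReal.ofReal (2 * a * (a / t)) := by
  have ht : 0 < a / t := div_pos ha (ha.trans hat)
  have hm : Measurable ((Set.Iic (a / t)).indicator (1 : ℝ → ℝ≥0∞)) :=
    measurable_one.indicator measurableSet_Iic
  rw [lintegral_const_mul' _ _ ENNReal.ofReal_ne_top, lintegral_add_left hm,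
    lintegral_indicator_one measurableSet_Iic, lintegral_indicator_one measurableSet_Ici,
    Measure.restrict_apply measurableSet_Iic, Measure.restrict_apply measurableSet_Ici]
  have h1 : volume (Set.Iic (a / t) ∩ Set.Icc (0:ℝ) 1) ≤ ENNReal.ofReal (a / t) := by
    refine (measure_mono (t := Set.Icc 0 (a / t)) fun u hu => ⟨hu.2.1, hu.1⟩).trans ?_
    simp
  have h2 : volume (Set.Ici (1 - a / t) ∩ Set.Icc (0:ℝ) 1) ≤ ENNReal.ofReal (a / t) := by
    refine (measure_mono (t := Set.Icc (1 - a / t) 1) fun u hu => ⟨hu.1, hu.2.2⟩).trans ?_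
    simp
  refine (mul_le_mul_right (add_le_add h1 h2) _).trans (le_of_eq ?_)
  rw [← ENNReal.ofReal_add ht.le ht.le, ← ENNReal.ofReal_mul ha.le]
  congr 1
  ring

lemma tsum_massAbove_le_lintegral_splitSeq {a : ℝ} (ha : 0 < a) {p : ℕ → ℝ} (hp : p ∈ Omega1)
    (i : ℕ) :
    ENNReal.ofReal (p i ^ 2) * (∑' k, massAbove a (p k) +
      (massAtLevel a (p i) * aboveHalf a (p i) + massAtLevel a (p i) * aboveHalf a (p i))) ≤
    ENNReal.ofReal (p i ^ 2) *
        (∫⁻ u in Set.Icc (0:ℝ) 1, ∑' k, massAbove a (splitSeq p i u k)) +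
      ENNReal.ofReal (2 * a ^ 2) * ENNReal.ofReal (p i) := by
  have h0 := hp.1 i
  rcases lt_or_ge a (p i) with hai | hai
  · have hlevel : massAtLevel a (p i) = 0 := by simp [massAtLevel, not_le.mpr hai]
    have hpt : ∀ u ∈ Set.Icc (0:ℝ) 1, ∑' k, massAbove a (p k) ≤
        ∑' k, massAbove a (splitSeq p i u k) + ENNReal.ofReal a *
          ((Set.Iic (a / p i)).indicator 1 u + (Set.Ici (1 - a / p i)).indicator 1 u) := by
      intro u hu
      have h1 := tsum_massAbove_add_le_splitSeq ha hp i hu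
      have h2 := massAbove_le_split ha hai hu
      refine ENNReal.le_of_add_le_add_right
        (ENNReal.add_ne_top.mpr ⟨massAbove_ne_top a (u * p i), massAbove_ne_top a ((1 - u) * p i)⟩)
        (h1.trans ((add_le_add_right h2 _).trans (le_of_eq ?_)))
      ring
    have hint : ∑' k, massAbove a (p k) ≤
        (∫⁻ u in Set.Icc (0:ℝ) 1, ∑' k, massAbove a (splitSeq p i u k)) +
          ENNReal.ofReal (2 * a * (a / p i)) := by
      have hconst : ∑' k, massAbove a (p k) =
          ∫⁻ _u in Set.Icc (0:ℝ) 1, ∑' k, massAbove a (p k) := by simp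
      have hmeas : Measurable fun u => ∑' k, massAbove a (splitSeq p i u k) :=
        Measurable.tsum fun k => (measurable_massAbove a).comp
          ((measurable_pi_apply k).comp (measurable_splitSeq_right p i))
      rw [hconst]
      refine (setLIntegral_mono' measurableSet_Icc hpt).trans ?_
      rw [lintegral_add_left hmeas]
      exact add_le_add_right (lintegral_splitLoss_le ha hai) _
    rw [hlevel, zero_mul, add_zero, add_zero]
    refine (mul_le_mul_right hint _).trans (le_of_eq ?_)
    have hpos : 0 < p i := ha.trans hai
    rw [mul_add, ← ENNReal.ofReal_mul (by positivity), ← ENNReal.ofReal_mul (by positivity)]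
    congr 2
    field_simp
  · have hint : ∑' k, massAbove a (p k) ≤
        ∫⁻ u in Set.Icc (0:ℝ) 1, ∑' k, massAbove a (splitSeq p i u k) := by
      have hconst : ∑' k, massAbove a (p k) =
          ∫⁻ _u in Set.Icc (0:ℝ) 1, ∑' k, massAbove a (p k) := by simp
      rw [hconst]
      refine setLIntegral_mono' measurableSet_Icc fun u hu => ?_
      have h1 := tsum_massAbove_add_le_splitSeq ha hp i hu
      rw [show massAbove a (p i) = 0 by simp [massAbove, not_lt.mpr hai], add_zero] at h1
      exact le_self_add.trans h1
    rw [mul_add]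
    refine add_le_add (mul_le_mul_right hint _) ?_
    have hL : massAtLevel a (p i) ≤ ENNReal.ofReal (p i) := by
      refine ENNReal.ofReal_le_ofReal ?_
      split_ifs <;> linarith
    have hE : aboveHalf a (p i) ≤ 1 := by
      refine ENNReal.ofReal_le_one.mpr ?_
      split_ifs <;> norm_num
    have hLE : massAtLevel a (p i) * aboveHalf a (p i) ≤ ENNReal.ofReal (p i) :=
      (mul_le_mul' hL hE).trans_eq (mul_one _)
    refine (mul_le_mul_right (add_le_add hLE hLE) _).trans ?_
    rw [← ENNReal.ofReal_add h0 h0, ← ENNReal.ofReal_mul (by positivity),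
      ← ENNReal.ofReal_mul (by positivity)]
    refine ENNReal.ofReal_le_ofReal ?_
    nlinarith [mul_le_mul hai hai h0 ha.le]

lemma card_level_le_tsum {a : ℝ} (ha : 0 < a) (p : ℕ → ℝ) :
    ENNReal.ofReal (a ^ 2 / 4) * (Nat.card {i : ℕ | p i ∈ Set.Ioc (a / 2) a} : ℝ≥0∞) ≤
      ∑' i, ENNReal.ofReal (p i) * massAtLevel a (p i) := by
  have hcard : (Nat.card {i : ℕ | p i ∈ Set.Ioc (a / 2) a} : ℝ≥0∞) ≤
      ∑' i : {i : ℕ | p i ∈ Set.Ioc (a / 2) a}, (1 : ℝ≥0∞) := by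
    rw [ENNReal.tsum_set_one, Nat.card_coe_set_eq]
    by_cases hf : {i : ℕ | p i ∈ Set.Ioc (a / 2) a}.Finite
    · rw [← hf.cast_ncard_eq]; simp
    · rw [Set.Infinite.ncard hf]; simp
  refine (mul_le_mul_right hcard _).trans ?_
  rw [tsum_subtype {i : ℕ | p i ∈ Set.Ioc (a / 2) a} fun _ => (1 : ℝ≥0∞), ← ENNReal.tsum_mul_left]
  refine ENNReal.tsum_le_tsum fun i => ?_
  by_cases h : p i ∈ Set.Ioc (a / 2) a
  · have h' : a / 2 < p i ∧ p i ≤ a := h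
    have hpos : 0 ≤ p i := by linarith [h'.1]
    rw [Set.indicator_of_mem (by exact h), mul_one, massAtLevel, if_pos h',
      ← ENNReal.ofReal_mul hpos]
    refine ENNReal.ofReal_le_ofReal ?_
    nlinarith [h'.1]
  · rw [Set.indicator_of_notMem (by exact h), mul_zero]
    exact zero_le

lemma ofReal_tsum_aboveHalf {p : ℕ → ℝ} (hp : p ∈ Omega1) (a : ℝ) :
    ENNReal.ofReal (∑' j, if a / 2 < p j then p j else 0) =
      ∑' j, ENNReal.ofReal (p j) * aboveHalf a (p j) := by
  have h0 : ∀ j, 0 ≤ if a / 2 < p j then p j else 0 := by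
    intro j; have := hp.1 j; split_ifs <;> simp [this]
  rw [ENNReal.ofReal_tsum_of_nonneg h0
    (Summable.of_nonneg_of_le h0 (fun j => ?_) (summable_of_mem_Omega1 hp))]
  · refine tsum_congr fun j => ?_
    rw [aboveHalf, ← ENNReal.ofReal_mul (hp.1 j)]
    simp
  · have := hp.1 j
    split_ifs <;> simp [this]

/-- Drift inequality for the total mass of the parts exceeding `a`. -/
lemma tsum_massAbove_add_le_lintegral_CCFlaw {a : ℝ} (ha : 0 < a) {p : ℕ → ℝ}
    (hp : p ∈ Omega1) :
    ∑' i, massAbove a (p i) + ENNReal.ofReal (a ^ 2 / 2) *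
      ((Nat.card {i : ℕ | p i ∈ Set.Ioc (a / 2) a} : ℝ≥0∞) *
        ENNReal.ofReal (∑' j, if a / 2 < p j then p j else 0)) ≤
    ∫⁻ q, ∑' i, massAbove a (q i) ∂CCFlaw p + ENNReal.ofReal (2 * a ^ 2) := by
  have hsum := tsum_ofReal_of_mem_Omega1 hp
  set Φ := ∑' i, massAbove a (p i)
  set w : ℕ → ℝ≥0∞ := fun i => ENNReal.ofReal (p i)
  set d : ℕ → ℝ≥0∞ := fun i => massAtLevel a (p i)
  set e : ℕ → ℝ≥0∞ := fun i => aboveHalf a (p i)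
  have hw : ∑' i, w i = 1 := hsum
  have hterm : ∀ i j, w i * w j * (Φ + (d i * e j + d j * e i)) ≤
      (if i ≠ j then ENNReal.ofReal (p i * p j) * ∑' k, massAbove a (mergeSeq p i j k)
      else ENNReal.ofReal (p i ^ 2) *
        ∫⁻ u in Set.Icc (0:ℝ) 1, ∑' k, massAbove a (splitSeq p i u k)) +
      if j = i then ENNReal.ofReal (2 * a ^ 2) * w i else 0 := by
    intro i j
    have hww : w i * w j = ENNReal.ofReal (p i * p j) := (ENNReal.ofReal_mul (hp.1 i)).symm
    rw [hww]
    by_cases hij : i = j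
    · subst hij
      simp only [ne_eq, not_true_eq_false, if_false, if_true]
      rw [← pow_two]
      exact tsum_massAbove_le_lintegral_splitSeq ha hp i
    · rw [if_pos hij, if_neg (Ne.symm hij), add_zero]
      exact mul_le_mul_right (tsum_massAbove_le_mergeSeq ha hp hij) _
  have hlhs : ∑' i, ∑' j, w i * w j * (Φ + (d i * e j + d j * e i)) =
      Φ + 2 * ((∑' i, w i * d i) * ∑' j, w j * e j) := by
    have hrow : ∀ i, ∑' j, w i * w j * (Φ + (d i * e j + d j * e i)) =
        w i * Φ + (w i * d i * (∑' j, w j * e j) + w i * e i * ∑' j, w j * d j) := by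
      intro i
      calc ∑' j, w i * w j * (Φ + (d i * e j + d j * e i))
          = ∑' j, (w i * Φ * w j + (w i * d i * (w j * e j) + w i * e i * (w j * d j))) :=
            tsum_congr fun j => by ring
        _ = _ := by
            rw [ENNReal.tsum_add, ENNReal.tsum_add, ENNReal.tsum_mul_left, ENNReal.tsum_mul_left,
              ENNReal.tsum_mul_left, hw, mul_one]
    rw [tsum_congr hrow, ENNReal.tsum_add, ENNReal.tsum_add, ENNReal.tsum_mul_right,
      ENNReal.tsum_mul_right, ENNReal.tsum_mul_right, hw, one_mul]
    ring
  have hmeas : Measurable fun q : ℕ → ℝ => ∑' i, massAbove a (q i) :=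
    Measurable.tsum fun k => (measurable_massAbove a).comp (measurable_pi_apply k)
  have hle := ENNReal.tsum_le_tsum fun i => ENNReal.tsum_le_tsum fun j => hterm i j
  simp only [ENNReal.tsum_add, tsum_ite_eq, ENNReal.tsum_mul_left] at hle
  rw [hw, mul_one, ← lintegral_CCFlaw p hmeas] at hle
  refine le_trans ?_ hle
  refine le_trans (add_le_add_right ?_ Φ) hlhs.ge
  rw [ofReal_tsum_aboveHalf hp, show a ^ 2 / 2 = 2 * (a ^ 2 / 4) by ring,
    ENNReal.ofReal_mul zero_le_two, ENNReal.ofReal_ofNat, ← mul_assoc, mul_assoc 2, mul_assoc 2]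
  exact mul_le_mul_right (mul_le_mul_left (card_level_le_tsum ha p) _) _

/-- **Dyadic level inequality** (inequality (6.1)): if `μ` is CCF-invariant,
then for every `n ≥ 1`,
`∫ #{i : pᵢ ∈ (2^{−n−1}, 2^{−n}]} · (Σⱼ pⱼ 1{pⱼ > 2^{−n−1}}) dμ ≤ 4`. -/
theorem dyadic_level_inequality (μ : Measure (ℕ → ℝ)) (hμ : CCFInvariant μ)
    (n : ℕ) (hn : 1 ≤ n) :
    ∫⁻ p, (Nat.card {i : ℕ |
        p i ∈ Set.Ioc ((2:ℝ) ^ (-(n : ℤ) - 1)) ((2:ℝ) ^ (-(n : ℤ)))} : ℝ≥0∞) *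
      ENNReal.ofReal (∑' j : ℕ, if (2:ℝ) ^ (-(n : ℤ) - 1) < p j then p j else 0) ∂μ
      ≤ 4 := by
  obtain ⟨hprob, hΩ, -⟩ := id hμ
  have hae : ∀ᵐ p ∂μ, p ∈ Omega1 :=
    (prob_compl_eq_zero_iff measurableSet_Omega1).mpr hΩ
  set a : ℝ := (2:ℝ) ^ (-(n : ℤ)) with ha_def
  have ha : 0 < a := by positivity
  rw [show (2:ℝ) ^ (-(n : ℤ) - 1) = a / 2 by rw [zpow_sub₀ two_ne_zero, zpow_one]]
  set Φ : (ℕ → ℝ) → ℝ≥0∞ := fun p => ∑' i, massAbove a (p i)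
  have hmeas : Measurable Φ :=
    Measurable.tsum fun k => (measurable_massAbove a).comp (measurable_pi_apply k)
  have hΦ : ∫⁻ p, Φ p ∂μ ≠ ∞ := by
    refine ne_top_of_le_ne_top ENNReal.one_ne_top ?_
    calc ∫⁻ p, Φ p ∂μ ≤ ∫⁻ _p, 1 ∂μ := by
          refine lintegral_mono_ae (hae.mono fun p hp => ?_)
          rw [← tsum_ofReal_of_mem_Omega1 hp]
          refine ENNReal.tsum_le_tsum fun i => ENNReal.ofReal_le_ofReal ?_
          have := hp.1 i
          split_ifs <;> simp [this]
      _ = 1 := by simp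
  have hc0 : ENNReal.ofReal (a ^ 2 / 2) ≠ 0 := by simp [ha]
  have hdrift := (le_lintegral_add _ _).trans (lintegral_mono_ae
    (hae.mono fun p hp => tsum_massAbove_add_le_lintegral_CCFlaw ha hp))
  rw [lintegral_add_right _ measurable_const, hμ.lintegral_lintegral hmeas, lintegral_const,
    measure_univ, mul_one, lintegral_const_mul' _ _ ENNReal.ofReal_ne_top] at hdrift
  have h4 := ENNReal.le_of_add_le_add_left hΦ hdrift
  rw [show 2 * a ^ 2 = a ^ 2 / 2 * 4 by ring, ENNReal.ofReal_mul (by positivity),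
    ENNReal.ofReal_ofNat] at h4
  exact (ENNReal.mul_le_mul_iff_right hc0 ENNReal.ofReal_ne_top).mp h4

end
end

section
/- (Recurrence of the trivial partition for CCF) The state s = (1,0,0,…) ∈ Ω₁ is recurrent for the CCF chain: if (p(k))_{k≥0} is the CCF chain started at p(0) = s, then almost surely p(k) = s for some k ≥ 1 (hence, by the strong Markov property, for infinitely many k). -/
open MeasureTheory ENNReal Filter Set

noncomputable section

/-- The σ-algebra generated by the process `X` up to time `k`. -/
def filtrationTo {Ω S : Type*} [MeasurableSpace S] (X : ℕ → Ω → S) (k : ℕ) :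
    MeasurableSpace Ω :=
  ⨆ i ∈ Finset.range (k + 1), MeasurableSpace.comap (X i) inferInstance

/-- `(X k)` is a CCF Markov chain on `(Ω, P)`: it takes values in `Ω₁` and has
the Markov property with the CCF transition kernel. -/
def IsCCFChain {Ω : Type*} [MeasurableSpace Ω] (P : Measure Ω)
    (X : ℕ → Ω → (ℕ → ℝ)) : Prop :=
  (∀ k ω, X k ω ∈ Omega1) ∧
  ∀ (k : ℕ) (A : Set (ℕ → ℝ)), MeasurableSet A →
    ∀ B : Set Ω, MeasurableSet[filtrationTo X k] B →
      P (B ∩ {ω | X (k + 1) ω ∈ A}) = ∫⁻ ω in B, CCFstep (X k ω) A ∂P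

/-! ### Hyperbolic power series -/

/-- The power series `e^{aX} - e^{-aX}`. -/
def sinhSeries (a : ℝ) : PowerSeries ℝ :=
  PowerSeries.rescale a (PowerSeries.exp ℝ) - PowerSeries.rescale (-a) (PowerSeries.exp ℝ)

/-- The power series `e^{aX} + e^{-aX}`. -/
def coshSeries (a : ℝ) : PowerSeries ℝ :=
  PowerSeries.rescale a (PowerSeries.exp ℝ) + PowerSeries.rescale (-a) (PowerSeries.exp ℝ)

/-- The coefficientwise average over `u ∈ [0,1]` of `sinhSeries (u a) * sinhSeries ((1 - u) a)`. -/
def splitSeries (a : ℝ) : PowerSeries ℝ :=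
  PowerSeries.mk fun n => ∫ u in (0:ℝ)..1,
    PowerSeries.coeff n (sinhSeries (u * a) * sinhSeries ((1 - u) * a))

lemma coeff_rescale_exp (a : ℝ) (n : ℕ) :
    PowerSeries.coeff n (PowerSeries.rescale a (PowerSeries.exp ℝ)) = a ^ n / n.factorial := by
  simp [PowerSeries.coeff_rescale, PowerSeries.coeff_exp, div_eq_mul_inv]

lemma coeff_sinhSeries (a : ℝ) (n : ℕ) :
    PowerSeries.coeff n (sinhSeries a) = (a ^ n - (-a) ^ n) / n.factorial := by
  simp only [sinhSeries, map_sub, coeff_rescale_exp, sub_div]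

lemma coeff_coshSeries (a : ℝ) (n : ℕ) :
    PowerSeries.coeff n (coshSeries a) = (a ^ n + (-a) ^ n) / n.factorial := by
  simp only [coshSeries, map_add, coeff_rescale_exp, add_div]

lemma sinhSeries_add (a b : ℝ) :
    2 * sinhSeries (a + b) = sinhSeries a * coshSeries b + coshSeries a * sinhSeries b := by
  simp only [sinhSeries, coshSeries, neg_add, ← PowerSeries.exp_mul_exp_eq_exp_add]
  ring

lemma sinhSeries_mul (a b : ℝ) :
    sinhSeries a * sinhSeries b = coshSeries (a + b) - coshSeries (a - b) := by
  simp only [sinhSeries, coshSeries, neg_add, neg_neg, sub_eq_add_neg a b,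
    ← PowerSeries.exp_mul_exp_eq_exp_add]
  ring

lemma derivative_sinhSeries (a : ℝ) :
    PowerSeries.derivative ℝ (sinhSeries a) = PowerSeries.C a * coshSeries a := by
  ext n
  rw [PowerSeries.coeff_derivative, coeff_sinhSeries, PowerSeries.coeff_C_mul, coeff_coshSeries,
    Nat.factorial_succ]
  push_cast
  have : (n.factorial : ℝ) ≠ 0 := by positivity
  have : (n : ℝ) + 1 ≠ 0 := by positivity
  field_simp
  ring

lemma coeff_sinhSeries_mul_split (a u : ℝ) (n : ℕ) :
    PowerSeries.coeff n (sinhSeries (u * a) * sinhSeries ((1 - u) * a)) =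
      (a ^ n + (-a) ^ n) / n.factorial
        - (a ^ n + (-a) ^ n) / n.factorial * (2 * u - 1) ^ n := by
  rw [sinhSeries_mul, map_sub, coeff_coshSeries, coeff_coshSeries]
  rw [show u * a + (1 - u) * a = a by ring, show u * a - (1 - u) * a = (2 * u - 1) * a by ring,
    ← mul_neg, mul_pow, mul_pow]
  ring

lemma X_mul_splitSeries (a : ℝ) :
    PowerSeries.X * (PowerSeries.C (a ^ 2) * splitSeries a) =
      PowerSeries.X * (PowerSeries.C (a ^ 2) * coshSeries a) - PowerSeries.C a * sinhSeries a := by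
  ext n
  cases n with
  | zero =>
    rw [map_sub, PowerSeries.coeff_zero_X_mul, PowerSeries.coeff_zero_X_mul,
      PowerSeries.coeff_C_mul, coeff_sinhSeries]
    simp
  | succ n =>
    rw [PowerSeries.coeff_succ_X_mul, map_sub, PowerSeries.coeff_succ_X_mul]
    simp only [PowerSeries.coeff_C_mul, splitSeries, PowerSeries.coeff_mk,
      coeff_sinhSeries_mul_split, coeff_sinhSeries, coeff_coshSeries]
    rw [intervalIntegral.integral_sub (by simp)
      (Continuous.intervalIntegrable (by fun_prop) _ _), intervalIntegral.integral_const,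
      intervalIntegral.integral_const_mul]
    have h : ∫ u in (0:ℝ)..1, (2 * u - 1) ^ n = (1 - (-1) ^ (n + 1)) / (2 * (n + 1)) := by
      rw [intervalIntegral.integral_comp_mul_sub (fun x : ℝ => x ^ n) two_ne_zero, integral_pow]
      norm_num
      field_simp
    rw [h, Nat.factorial_succ, smul_eq_mul]
    push_cast
    have : (n.factorial : ℝ) ≠ 0 := by positivity
    have : (n : ℝ) + 1 ≠ 0 := by positivity
    field_simp
    rw [neg_pow a n, neg_pow a (n+1)]
    rcases neg_one_pow_eq_or ℝ n with h | h <;> simp only [pow_succ, h] <;> ring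

lemma derivative_prod_powerSeries {ι : Type*} [DecidableEq ι] (A : Finset ι)
    (f : ι → PowerSeries ℝ) :
    PowerSeries.derivative ℝ (∏ i ∈ A, f i) =
      ∑ i ∈ A, PowerSeries.derivative ℝ (f i) * ∏ j ∈ A.erase i, f j := by
  induction A using Finset.induction_on with
  | empty => simp
  | insert a s ha ih =>
    rw [Finset.prod_insert ha, Derivation.leibniz, Finset.sum_insert ha, Finset.erase_insert ha, ih]
    simp only [smul_eq_mul, Finset.mul_sum]
    rw [add_comm, mul_comm]
    congr 1
    refine Finset.sum_congr rfl fun i hi => ?_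
    have hne : a ≠ i := fun h => ha (h ▸ hi)
    rw [Finset.erase_insert_of_ne hne, Finset.prod_insert (by simp [ha])]
    ring

/-- The contribution of the sampled pair `(i, j)` to the action of the split-merge dynamics on the
generating series `∏ i ∈ A, sinhSeries (a i)`. -/
def pairSeries (A : Finset ℕ) (a : ℕ → ℝ) (i j : ℕ) : PowerSeries ℝ :=
  if i ≠ j then
    PowerSeries.C (a i * a j) *
      (sinhSeries (a i + a j) * ∏ l ∈ (A.erase i).erase j, sinhSeries (a l))
  else PowerSeries.C (a i ^ 2) * (splitSeries (a i) * ∏ l ∈ A.erase i, sinhSeries (a l))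

lemma X_mul_pairSeries (A : Finset ℕ) (a : ℕ → ℝ) {i j : ℕ} (hi : i ∈ A) (hj : j ∈ A) :
    PowerSeries.X * pairSeries A a i j =
      PowerSeries.X * (PowerSeries.C (a i * a j / 2) *
        (coshSeries (a i) * ∏ l ∈ A.erase i, sinhSeries (a l)
          + coshSeries (a j) * ∏ l ∈ A.erase j, sinhSeries (a l)))
      - if i = j then PowerSeries.C (a i) * ∏ l ∈ A, sinhSeries (a l) else 0 := by
  have hC : ∀ r : ℝ, PowerSeries.C r = 2 * PowerSeries.C (r / 2) := by
    intro r
    have : (2 : PowerSeries ℝ) = PowerSeries.C 2 := (map_ofNat PowerSeries.C 2).symm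
    rw [this, ← map_mul]; congr 1; ring
  by_cases h : i = j
  · subst h
    simp only [pairSeries, ne_eq, not_true_eq_false, if_false, if_true]
    have h1 := X_mul_splitSeries (a i)
    rw [← Finset.mul_prod_erase A _ hi, ← pow_two]
    rw [hC (a i ^ 2)] at h1 ⊢
    linear_combination (∏ l ∈ A.erase i, sinhSeries (a l)) * h1
  · have hji : j ∈ A.erase i := Finset.mem_erase.2 ⟨fun e => h e.symm, hj⟩
    have hij : i ∈ A.erase j := Finset.mem_erase.2 ⟨h, hi⟩
    simp only [pairSeries, ne_eq, h, not_false_eq_true, if_false, if_true, sub_zero]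
    rw [← Finset.mul_prod_erase _ _ hji, ← Finset.mul_prod_erase _ _ hij,
      Finset.erase_right_comm (a := j) (b := i), hC (a i * a j)]
    linear_combination (PowerSeries.X * PowerSeries.C (a i * a j / 2)
      * ∏ l ∈ (A.erase i).erase j, sinhSeries (a l)) * sinhSeries_add (a i) (a j)

lemma X_mul_sum_pairSeries (A : Finset ℕ) (a : ℕ → ℝ) (hsum : ∑ i ∈ A, a i = 1) :
    PowerSeries.X * ∑ i ∈ A, ∑ j ∈ A, pairSeries A a i j =
      PowerSeries.X * PowerSeries.derivative ℝ (∏ l ∈ A, sinhSeries (a l))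
        - ∏ l ∈ A, sinhSeries (a l) := by
  have hsumC : ∑ i ∈ A, PowerSeries.C (a i) = (1 : PowerSeries ℝ) := by
    rw [← map_sum, hsum, map_one]
  have hC : ∀ r s : ℝ, PowerSeries.C (r * s / 2) =
      PowerSeries.C (1 / 2 : ℝ) * (PowerSeries.C r * PowerSeries.C s) := by
    intro r s; rw [← map_mul, ← map_mul]; congr 1; ring
  have hhalf : PowerSeries.C (1 / 2 : ℝ) * 2 = 1 := by
    have : (2 : PowerSeries ℝ) = PowerSeries.C 2 := (map_ofNat PowerSeries.C 2).symm
    rw [this, ← map_mul]; norm_num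
  set D : ℕ → PowerSeries ℝ := fun i => coshSeries (a i) * ∏ l ∈ A.erase i, sinhSeries (a l)
    with hD
  have e1 : ∀ i ∈ A, ∑ j ∈ A, PowerSeries.X * pairSeries A a i j =
      PowerSeries.X * PowerSeries.C (1 / 2 : ℝ) * (PowerSeries.C (a i) * D i
        + PowerSeries.C (a i) * ∑ j ∈ A, PowerSeries.C (a j) * D j)
      - PowerSeries.C (a i) * ∏ l ∈ A, sinhSeries (a l) := by
    intro i hi
    rw [Finset.sum_congr rfl fun j hj => X_mul_pairSeries A a hi hj, Finset.sum_sub_distrib,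
      Finset.sum_ite_eq, if_pos hi]
    congr 1
    have : ∀ j ∈ A, PowerSeries.X * (PowerSeries.C (a i * a j / 2) * (D i + D j)) =
        PowerSeries.C (a j) *
          (PowerSeries.X * PowerSeries.C (1 / 2 : ℝ) * PowerSeries.C (a i) * D i)
        + PowerSeries.X * PowerSeries.C (1 / 2 : ℝ) * PowerSeries.C (a i)
          * (PowerSeries.C (a j) * D j) := by
      intro j _; rw [hC]; ring
    rw [Finset.sum_congr rfl this, Finset.sum_add_distrib, ← Finset.sum_mul, ← Finset.mul_sum,
      hsumC]
    ring
  simp only [Finset.mul_sum]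
  rw [Finset.sum_congr rfl e1, Finset.sum_sub_distrib, ← Finset.mul_sum, Finset.sum_add_distrib,
    ← Finset.sum_mul, ← Finset.sum_mul, hsumC, derivative_prod_powerSeries]
  have : ∑ i ∈ A, PowerSeries.derivative ℝ (sinhSeries (a i)) * ∏ j ∈ A.erase i, sinhSeries (a j)
      = ∑ i ∈ A, PowerSeries.C (a i) * D i :=
    Finset.sum_congr rfl fun i _ => by rw [derivative_sinhSeries, hD]; ring
  rw [this]
  linear_combination (PowerSeries.X * ∑ i ∈ A, PowerSeries.C (a i) * D i) * hhalf

lemma coeff_sum_pairSeries (A : Finset ℕ) (a : ℕ → ℝ) (hsum : ∑ i ∈ A, a i = 1) (k : ℕ) :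
    ∑ i ∈ A, ∑ j ∈ A, PowerSeries.coeff (k + 1) (pairSeries A a i j) =
      (k + 1) * PowerSeries.coeff (k + 2) (∏ l ∈ A, sinhSeries (a l)) := by
  have h := congrArg (PowerSeries.coeff (k + 2)) (X_mul_sum_pairSeries A a hsum)
  rw [PowerSeries.coeff_succ_X_mul, map_sub, PowerSeries.coeff_succ_X_mul,
    PowerSeries.coeff_derivative] at h
  simp only [map_sum] at h
  rw [h]
  push_cast
  ring

/-! ### Nonincreasing rearrangements -/

lemma dRearrange_comp_perm (x : ℕ → ℝ) (σ : Equiv.Perm ℕ) :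
    dRearrange (x ∘ σ) = dRearrange x := by
  funext n
  have h : ∀ t : ℝ, {i | t < (x ∘ σ) i} = σ.symm '' {i | t < x i} := by
    intro t
    rw [Equiv.image_symm_eq_preimage]
    rfl
  simp only [dRearrange, h, Set.finite_image_iff σ.symm.injective.injOn,
    Nat.card_image_of_injective σ.symm.injective]

lemma dRearrange_of_antitone {y : ℕ → ℝ} (hy : Antitone y) : dRearrange y = y := by
  funext n
  have h : {t : ℝ | {i | t < y i}.Finite ∧ Nat.card {i | t < y i} ≤ n} = Set.Ici (y n) := by
    ext t
    simp only [Set.mem_ofPred_eq, Set.mem_Ici]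
    constructor
    · rintro ⟨hf, hc⟩
      by_contra! hlt
      have hsub : (Finset.range (n + 1) : Set ℕ) ⊆ {i | t < y i} := by
        intro i hi
        have : i ≤ n := Nat.lt_succ_iff.1 (by simpa using hi)
        exact hlt.trans_le (hy this)
      have := Nat.card_mono hf hsub
      simp at this
      simp at hc
      omega
    · intro ht
      have h1 : {i | t < y i} ⊆ (Finset.range n : Set ℕ) := by
        intro i hi
        by_contra hin
        have : n ≤ i := by simpa using hin
        exact absurd (hi.trans_le (hy this)) (not_lt.2 ht)
      refine ⟨(Finset.finite_toSet _).subset h1, ?_⟩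
      simpa using Nat.card_mono (Finset.finite_toSet _) h1
  rw [dRearrange, h, csInf_Ici]

lemma exists_perm_antitone {x : ℕ → ℝ} (h0 : ∀ i, 0 ≤ x i) (hfin : (Function.support x).Finite) :
    ∃ σ : Equiv.Perm ℕ, Antitone (x ∘ σ) := by
  obtain ⟨M, hM⟩ := hfin.bddAbove
  have hM' : ∀ i, M + 1 ≤ i → x i = 0 := by
    intro i hi
    by_contra h
    have := hM (Function.mem_support.2 h)
    omega
  set τ := Tuple.sort (fun i : Fin (M + 1) => - x i)
  have hmono := Tuple.monotone_sort (fun i : Fin (M + 1) => - x i)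
  refine ⟨τ.extendDomain Fin.equivSubtype, ?_⟩
  have hlt : ∀ i (hi : i < M + 1), (τ.extendDomain Fin.equivSubtype) i = (τ ⟨i, hi⟩ : ℕ) := by
    intro i hi
    rw [Equiv.Perm.extendDomain_apply_subtype τ Fin.equivSubtype hi]
    rfl
  intro i j hij
  simp only [Function.comp_apply]
  by_cases hj : j < M + 1
  · have hi : i < M + 1 := lt_of_le_of_lt hij hj
    rw [hlt i hi, hlt j hj]
    have := hmono (show (⟨i, hi⟩ : Fin (M + 1)) ≤ ⟨j, hj⟩ from hij)
    simpa using this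
  · rw [Equiv.Perm.extendDomain_apply_not_subtype τ Fin.equivSubtype hj, hM' j (by omega)]
    exact h0 _

lemma exists_perm_dRearrange {x : ℕ → ℝ} (h0 : ∀ i, 0 ≤ x i)
    (hfin : (Function.support x).Finite) : ∃ σ : Equiv.Perm ℕ, dRearrange x = x ∘ σ := by
  obtain ⟨σ, hσ⟩ := exists_perm_antitone h0 hfin
  refine ⟨σ, ?_⟩
  rw [← dRearrange_comp_perm x σ]
  exact dRearrange_of_antitone hσ

/-! ### Finite partitions and their generating series -/

/-- Partitions of `[0,1]` into finitely many parts, in any order. -/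
def IsFinPartition (p : ℕ → ℝ) : Prop :=
  (∀ i, 0 ≤ p i) ∧ (Function.support p).Finite ∧ ∑ᶠ i, p i = 1

/-- `sinhSeries a`, with the value `1` for an empty part. -/
def partSeries (a : ℝ) : PowerSeries ℝ := if a = 0 then 1 else sinhSeries a

/-- The product of `sinhSeries` over the nonempty parts. -/
def partitionSeries (p : ℕ → ℝ) : PowerSeries ℝ := ∏ᶠ i, partSeries (p i)

/-- The coefficients of `partitionSeries`, normalized to give the probability that the chain started
at a finite partition `p` is at the trivial partition at time `k`. -/
def hitValue (k : ℕ) (p : ℕ → ℝ) : ℝ :=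
  k.factorial / 2 * PowerSeries.coeff (k + 1) (partitionSeries p)

open Classical in
/-- `hitValue` as an extended nonnegative function, vanishing off finite partitions. -/
def hitProb (k : ℕ) (p : ℕ → ℝ) : ℝ≥0∞ :=
  if IsFinPartition p then ENNReal.ofReal (hitValue k p) else 0

@[to_additive]
lemma finprod_merge {M : Type*} [CommMonoid M] (g : ℝ → M) (hg : g 0 = 1) (p : ℕ → ℝ)
    (A : Finset ℕ) (hA : Function.support p ⊆ A) {i j : ℕ} (hi : i ∈ A) (hj : j ∈ A)
    (hij : i ≠ j) :
    ∏ᶠ m, g (if m = i then p i + p j else if m = j then 0 else p m) =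
      g (p i + p j) * ∏ l ∈ (A.erase i).erase j, g (p l) := by
  rw [finprod_eq_prod_of_mulSupport_subset (s := A)]
  · rw [← Finset.mul_prod_erase A _ hi,
      ← Finset.mul_prod_erase (A.erase i) _ (Finset.mem_erase.2 ⟨hij.symm, hj⟩)]
    simp only [if_true, if_neg hij.symm, hg, one_mul]
    congr 1
    refine Finset.prod_congr rfl fun l hl => ?_
    simp only [Finset.mem_erase] at hl
    rw [if_neg hl.2.1, if_neg hl.1]
  · intro m hm
    by_contra hmA
    have hmi : m ≠ i := fun h => hmA (h ▸ hi)
    have hmj : m ≠ j := fun h => hmA (h ▸ hj)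
    have hp : p m = 0 := by
      by_contra h
      exact hmA (hA h)
    simp [hmi, hmj, hp, hg] at hm

@[to_additive]
lemma finprod_split {M : Type*} [CommMonoid M] (g : ℝ → M) (hg : g 0 = 1) (p : ℕ → ℝ)
    (A : Finset ℕ) (hA : Function.support p ⊆ A) {i : ℕ} (hi : i ∈ A) (u : ℝ) :
    ∏ᶠ m, g (if m = 0 then u * p i else if m = 1 then (1 - u) * p i
      else if m - 2 = i then 0 else p (m - 2)) =
      g (u * p i) * (g ((1 - u) * p i) * ∏ l ∈ A.erase i, g (p l)) := by
  rw [finprod_eq_prod_of_mulSupport_subset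
    (s := insert 0 (insert 1 (A.map (addRightEmbedding 2))))]
  · rw [Finset.prod_insert (by simp), Finset.prod_insert (by simp), Finset.prod_map,
      ← Finset.mul_prod_erase A _ hi]
    simp [hg]
    congr 2
    refine Finset.prod_congr rfl fun l hl => ?_
    simp only [Finset.mem_erase] at hl
    rw [if_neg hl.1]
  · intro m hm
    by_contra hmA
    simp only [Finset.coe_insert, Finset.coe_map, Set.mem_insert_iff, not_or] at hmA
    have hp : p (m - 2) = 0 := by
      by_contra h
      refine hmA.2.2 ⟨m - 2, hA h, ?_⟩
      simp
      omega
    simp [hmA.1, hmA.2.1, hp, hg] at hm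

lemma IsFinPartition.comp_perm {p : ℕ → ℝ} (hp : IsFinPartition p) (σ : Equiv.Perm ℕ) :
    IsFinPartition (p ∘ σ) := by
  refine ⟨fun i => hp.1 _, ?_, ?_⟩
  · rw [Function.support_comp_eq_preimage]
    exact hp.2.1.preimage σ.injective.injOn
  · rw [← hp.2.2]
    exact finsum_comp_equiv σ

lemma partitionSeries_comp_perm (p : ℕ → ℝ) (σ : Equiv.Perm ℕ) :
    partitionSeries (p ∘ σ) = partitionSeries p :=
  finprod_comp_equiv σ (f := fun i => partSeries (p i))

lemma IsFinPartition.dRearrange {p : ℕ → ℝ} (hp : IsFinPartition p) :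
    IsFinPartition (dRearrange p) := by
  obtain ⟨σ, hσ⟩ := exists_perm_dRearrange hp.1 hp.2.1
  exact hσ ▸ hp.comp_perm σ

lemma IsFinPartition.partitionSeries_dRearrange {p : ℕ → ℝ} (hp : IsFinPartition p) :
    partitionSeries (_root_.dRearrange p) = partitionSeries p := by
  obtain ⟨σ, hσ⟩ := exists_perm_dRearrange hp.1 hp.2.1
  rw [hσ, partitionSeries_comp_perm]

namespace IsFinPartition

/-- The finite set of indices of nonempty parts. -/
def parts {p : ℕ → ℝ} (hp : IsFinPartition p) : Finset ℕ := hp.2.1.toFinset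

lemma support_subset {p : ℕ → ℝ} (hp : IsFinPartition p) : Function.support p ⊆ hp.parts := by
  simp [parts]

lemma pos {p : ℕ → ℝ} (hp : IsFinPartition p) {i : ℕ} (hi : i ∈ hp.parts) : 0 < p i :=
  lt_of_le_of_ne (hp.1 i) (Ne.symm (by simpa [parts] using hi))

lemma eq_zero {p : ℕ → ℝ} (hp : IsFinPartition p) {i : ℕ} (hi : i ∉ hp.parts) : p i = 0 := by
  simpa [parts] using hi

lemma sum_parts {p : ℕ → ℝ} (hp : IsFinPartition p) : ∑ i ∈ hp.parts, p i = 1 := by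
  rw [← hp.2.2, finsum_eq_sum_of_support_subset _ hp.support_subset]

end IsFinPartition

lemma partSeries_zero : partSeries 0 = 1 := if_pos rfl

lemma partSeries_of_pos {a : ℝ} (ha : 0 < a) : partSeries a = sinhSeries a := if_neg ha.ne'

namespace IsFinPartition

lemma partitionSeries_eq {p : ℕ → ℝ} (hp : IsFinPartition p) :
    partitionSeries p = ∏ i ∈ hp.parts, sinhSeries (p i) := by
  rw [partitionSeries, finprod_eq_prod_of_mulSupport_subset (s := hp.parts)]
  · exact Finset.prod_congr rfl fun i hi => partSeries_of_pos (hp.pos hi)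
  · intro i hi
    by_contra h
    exact hi (by simp only [hp.eq_zero h, partSeries_zero])

lemma merge {p : ℕ → ℝ} (hp : IsFinPartition p) {i j : ℕ} (hi : i ∈ hp.parts)
    (hj : j ∈ hp.parts) (hij : i ≠ j) :
    IsFinPartition (fun m => if m = i then p i + p j else if m = j then 0 else p m) := by
  refine ⟨fun m => ?_, ?_, ?_⟩
  · have := hp.1 i
    have := hp.1 j
    have := hp.1 m
    dsimp only
    split_ifs <;> linarith
  · refine (Finset.finite_toSet hp.parts).subset fun m hm => ?_
    by_contra h
    have hmi : m ≠ i := fun e => h (e ▸ hi)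
    have hmj : m ≠ j := fun e => h (e ▸ hj)
    simp [hmi, hmj, hp.eq_zero h] at hm
  · refine (finsum_merge id rfl p hp.parts hp.support_subset hi hj hij).trans ?_
    simp only [id]
    rw [← hp.sum_parts, ← Finset.add_sum_erase _ _ hi,
      ← Finset.add_sum_erase (hp.parts.erase i) _ (Finset.mem_erase.2 ⟨hij.symm, hj⟩), add_assoc]

lemma split {p : ℕ → ℝ} (hp : IsFinPartition p) {i : ℕ} (hi : i ∈ hp.parts) {u : ℝ}
    (hu : u ∈ Set.Icc (0:ℝ) 1) :
    IsFinPartition (fun m => if m = 0 then u * p i else if m = 1 then (1 - u) * p i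
      else if m - 2 = i then 0 else p (m - 2)) := by
  refine ⟨fun m => ?_, ?_, ?_⟩
  · have h1 := mul_nonneg hu.1 (hp.1 i)
    have h2 := mul_nonneg (sub_nonneg.2 hu.2) (hp.1 i)
    have h3 := hp.1 (m - 2)
    dsimp only
    split_ifs <;> first | assumption | exact le_rfl
  · refine (Finset.finite_toSet
      (insert 0 (insert 1 (hp.parts.map (addRightEmbedding 2))))).subset fun m hm => ?_
    by_contra hmA
    simp only [Finset.coe_insert, Finset.coe_map, Set.mem_insert_iff, not_or] at hmA
    have h : p (m - 2) = 0 := by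
      by_contra h
      refine hmA.2.2 ⟨m - 2, hp.support_subset h, ?_⟩
      simp
      omega
    simp [hmA.1, hmA.2.1, h] at hm
  · refine (finsum_split id rfl p hp.parts hp.support_subset hi u).trans ?_
    simp only [id]
    refine Eq.trans ?_ hp.sum_parts
    rw [← Finset.add_sum_erase _ _ hi]
    ring

lemma mergeSeq {p : ℕ → ℝ} (hp : IsFinPartition p) {i j : ℕ} (hi : i ∈ hp.parts)
    (hj : j ∈ hp.parts) (hij : i ≠ j) : IsFinPartition (mergeSeq p i j) :=
  (hp.merge hi hj hij).dRearrange

lemma splitSeq {p : ℕ → ℝ} (hp : IsFinPartition p) {i : ℕ} (hi : i ∈ hp.parts) {u : ℝ}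
    (hu : u ∈ Set.Icc (0:ℝ) 1) : IsFinPartition (splitSeq p i u) :=
  (hp.split hi hu).dRearrange

lemma hitValue_mergeSeq {p : ℕ → ℝ} (hp : IsFinPartition p) {i j : ℕ} (hi : i ∈ hp.parts)
    (hj : j ∈ hp.parts) (hij : i ≠ j) (k : ℕ) :
    hitValue k (_root_.mergeSeq p i j) = k.factorial / 2 * PowerSeries.coeff (k + 1)
      (sinhSeries (p i + p j) * ∏ l ∈ (hp.parts.erase i).erase j, sinhSeries (p l)) := by
  rw [hitValue, _root_.mergeSeq, (hp.merge hi hj hij).partitionSeries_dRearrange, partitionSeries,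
    finprod_merge partSeries partSeries_zero p hp.parts hp.support_subset hi hj hij,
    partSeries_of_pos (add_pos (hp.pos hi) (hp.pos hj))]
  congr 3
  refine Finset.prod_congr rfl fun l hl => partSeries_of_pos (hp.pos ?_)
  exact Finset.mem_of_mem_erase (Finset.mem_of_mem_erase hl)

lemma hitValue_splitSeq {p : ℕ → ℝ} (hp : IsFinPartition p) {i : ℕ} (hi : i ∈ hp.parts) {u : ℝ}
    (hu : u ∈ Set.Ioo (0:ℝ) 1) (k : ℕ) :
    hitValue k (_root_.splitSeq p i u) = k.factorial / 2 * PowerSeries.coeff (k + 1)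
      (sinhSeries (u * p i) * sinhSeries ((1 - u) * p i)
        * ∏ l ∈ hp.parts.erase i, sinhSeries (p l)) := by
  rw [hitValue, _root_.splitSeq,
    (hp.split hi (Set.Ioo_subset_Icc_self hu)).partitionSeries_dRearrange, partitionSeries,
    finprod_split partSeries partSeries_zero p hp.parts hp.support_subset hi,
    partSeries_of_pos (mul_pos hu.1 (hp.pos hi)),
    partSeries_of_pos (mul_pos (sub_pos.2 hu.2) (hp.pos hi)), mul_assoc (sinhSeries _)]
  congr 4
  exact Finset.prod_congr rfl fun l hl => partSeries_of_pos (hp.pos (Finset.mem_of_mem_erase hl))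

end IsFinPartition

/-! ### Nonnegativity of coefficients -/

lemma coeff_mul_nonneg {φ ψ : PowerSeries ℝ} (hφ : ∀ n, 0 ≤ PowerSeries.coeff n φ)
    (hψ : ∀ n, 0 ≤ PowerSeries.coeff n ψ) (n : ℕ) : 0 ≤ PowerSeries.coeff n (φ * ψ) := by
  rw [PowerSeries.coeff_mul]
  exact Finset.sum_nonneg fun _ _ => mul_nonneg (hφ _) (hψ _)

lemma coeff_prod_nonneg (A : Finset ℕ) {f : ℕ → PowerSeries ℝ}
    (hf : ∀ i ∈ A, ∀ n, 0 ≤ PowerSeries.coeff n (f i)) (n : ℕ) :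
    0 ≤ PowerSeries.coeff n (∏ i ∈ A, f i) := by
  induction A using Finset.induction_on generalizing n with
  | empty => simp [PowerSeries.coeff_one]; split_ifs <;> norm_num
  | insert a s ha ih =>
    rw [Finset.prod_insert ha]
    exact coeff_mul_nonneg (hf a (Finset.mem_insert_self _ _))
      (ih fun i hi => hf i (Finset.mem_insert_of_mem hi)) n

lemma coeff_sinhSeries_nonneg {a : ℝ} (ha : 0 ≤ a) (n : ℕ) :
    0 ≤ PowerSeries.coeff n (sinhSeries a) := by
  rw [coeff_sinhSeries, neg_pow]
  have := pow_nonneg ha n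
  rcases neg_one_pow_eq_or ℝ n with h | h <;> rw [h]
  · simp
  · have : 0 ≤ a ^ n - -1 * a ^ n := by linarith
    positivity

lemma coeff_splitSeries_nonneg {a : ℝ} (ha : 0 ≤ a) (n : ℕ) :
    0 ≤ PowerSeries.coeff n (splitSeries a) := by
  rw [splitSeries, PowerSeries.coeff_mk]
  refine intervalIntegral.integral_nonneg zero_le_one fun u hu => ?_
  exact coeff_mul_nonneg (coeff_sinhSeries_nonneg (mul_nonneg hu.1 ha))
    (coeff_sinhSeries_nonneg (mul_nonneg (sub_nonneg.2 hu.2) ha)) n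

lemma coeff_pairSeries_nonneg {p : ℕ → ℝ} (hp : ∀ i, 0 ≤ p i) (A : Finset ℕ) (i j n : ℕ) :
    0 ≤ PowerSeries.coeff n (pairSeries A p i j) := by
  rw [pairSeries]
  split_ifs
  · rw [PowerSeries.coeff_C_mul]
    refine mul_nonneg (mul_nonneg (hp i) (hp j)) (coeff_mul_nonneg
      (coeff_sinhSeries_nonneg (add_nonneg (hp i) (hp j)))
      (coeff_prod_nonneg _ fun l _ => coeff_sinhSeries_nonneg (hp l)) n)
  · rw [PowerSeries.coeff_C_mul]
    refine mul_nonneg (pow_nonneg (hp i) 2) (coeff_mul_nonneg (coeff_splitSeries_nonneg (hp i))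
      (coeff_prod_nonneg _ fun l _ => coeff_sinhSeries_nonneg (hp l)) n)

/-! ### The one-step operator -/

/-- The one-step operator of the chain, acting on extended nonnegative functions. -/
def ccfOp (f : (ℕ → ℝ) → ℝ≥0∞) (p : ℕ → ℝ) : ℝ≥0∞ :=
  ∑' i : ℕ, ∑' j : ℕ,
    if i ≠ j then ENNReal.ofReal (p i * p j) * f (mergeSeq p i j)
    else ENNReal.ofReal (p i ^ 2) * ∫⁻ u in Set.Icc (0:ℝ) 1, f (splitSeq p i u)

lemma ccfOp_mono {f g : (ℕ → ℝ) → ℝ≥0∞} (h : f ≤ g) : ccfOp f ≤ ccfOp g := by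
  intro p
  refine ENNReal.tsum_le_tsum fun i => ENNReal.tsum_le_tsum fun j => ?_
  split_ifs
  · exact mul_le_mul_right (h _) _
  · exact mul_le_mul_right (lintegral_mono fun u => h _) _

lemma ccfOp_add_le (f g : (ℕ → ℝ) → ℝ≥0∞) (p : ℕ → ℝ) :
    ccfOp f p + ccfOp g p ≤ ccfOp (f + g) p := by
  simp only [ccfOp]
  rw [← ENNReal.tsum_add]
  refine ENNReal.tsum_le_tsum fun i => ?_
  rw [← ENNReal.tsum_add]
  refine ENNReal.tsum_le_tsum fun j => ?_
  split_ifs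
  · rw [Pi.add_apply, mul_add]
  · rw [← mul_add]
    exact mul_le_mul_right (le_lintegral_add _ _) _

lemma mul_ccfOp_le (c : ℝ≥0∞) (f : (ℕ → ℝ) → ℝ≥0∞) (p : ℕ → ℝ) :
    c * ccfOp f p ≤ ccfOp (fun q => c * f q) p := by
  simp only [ccfOp]
  rw [← ENNReal.tsum_mul_left]
  refine ENNReal.tsum_le_tsum fun i => ?_
  rw [← ENNReal.tsum_mul_left]
  refine ENNReal.tsum_le_tsum fun j => ?_
  split_ifs
  · rw [mul_left_comm]
  · rw [mul_left_comm]
    exact mul_le_mul_right (lintegral_const_mul_le _ _) _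

lemma ccfOp_one {p : ℕ → ℝ} (h0 : ∀ i, 0 ≤ p i) (hs : HasSum p 1) : ccfOp 1 p = 1 := by
  have hp : ∑' i, ENNReal.ofReal (p i) = 1 := by
    rw [← ENNReal.ofReal_tsum_of_nonneg h0 hs.summable, hs.tsum_eq, ENNReal.ofReal_one]
  have h : ∀ i j : ℕ, (if i ≠ j then
        ENNReal.ofReal (p i * p j) * (1 : (ℕ → ℝ) → ℝ≥0∞) (mergeSeq p i j)
      else ENNReal.ofReal (p i ^ 2) * ∫⁻ u in Set.Icc (0:ℝ) 1,
        (1 : (ℕ → ℝ) → ℝ≥0∞) (splitSeq p i u)) = ENNReal.ofReal (p i) * ENNReal.ofReal (p j) := by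
    intro i j
    rw [← ENNReal.ofReal_mul (h0 i)]
    by_cases hij : i = j
    · subst hij
      simp [pow_two]
    · simp [hij]
  simp only [ccfOp, h, ENNReal.tsum_mul_left, hp, mul_one]

namespace IsFinPartition

lemma ccfOp_eq_sum {p : ℕ → ℝ} (hp : IsFinPartition p) (f : (ℕ → ℝ) → ℝ≥0∞) :
    ccfOp f p = ∑ i ∈ hp.parts, ∑ j ∈ hp.parts,
      if i ≠ j then ENNReal.ofReal (p i * p j) * f (_root_.mergeSeq p i j)
      else ENNReal.ofReal (p i ^ 2) * ∫⁻ u in Set.Icc (0:ℝ) 1, f (_root_.splitSeq p i u) := by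
  rw [ccfOp, tsum_eq_sum (s := hp.parts)]
  · refine Finset.sum_congr rfl fun i hi => ?_
    rw [tsum_eq_sum (s := hp.parts)]
    intro j hj
    rw [if_pos (fun h : i = j => hj (h ▸ hi)), hp.eq_zero hj]
    simp
  · intro i hi
    simp [hp.eq_zero hi]

lemma hitProb_splitSeq_ae {p : ℕ → ℝ} (hp : IsFinPartition p) {i : ℕ} (hi : i ∈ hp.parts)
    (k : ℕ) :
    (fun u => hitProb k (_root_.splitSeq p i u)) =ᵐ[volume.restrict (Set.Icc (0:ℝ) 1)]
      fun u => ENNReal.ofReal (k.factorial / 2 * PowerSeries.coeff (k + 1)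
        (sinhSeries (u * p i) * sinhSeries ((1 - u) * p i)
          * ∏ l ∈ hp.parts.erase i, sinhSeries (p l))) := by
  rw [← Measure.restrict_congr_set (Ioo_ae_eq_Icc (μ := volume) (a := (0:ℝ)) (b := 1))]
  filter_upwards [ae_restrict_mem measurableSet_Ioo] with u hu
  rw [hitProb, if_pos (hp.splitSeq hi (Set.Ioo_subset_Icc_self hu)), hp.hitValue_splitSeq hi hu]

lemma continuous_coeff_split (a : ℝ) (φ : PowerSeries ℝ) (n : ℕ) :
    Continuous fun u : ℝ => PowerSeries.coeff n
      (sinhSeries (u * a) * sinhSeries ((1 - u) * a) * φ) := by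
  simp only [PowerSeries.coeff_mul n, coeff_sinhSeries_mul_split]
  fun_prop

lemma integral_coeff_split (a : ℝ) (φ : PowerSeries ℝ) (n : ℕ) :
    ∫ u in (0:ℝ)..1, PowerSeries.coeff n
      (sinhSeries (u * a) * sinhSeries ((1 - u) * a) * φ) =
      PowerSeries.coeff n (splitSeries a * φ) := by
  simp only [PowerSeries.coeff_mul n, splitSeries, PowerSeries.coeff_mk]
  rw [intervalIntegral.integral_finsetSum]
  · simp only [intervalIntegral.integral_mul_const]
  · intro i _
    simp only [coeff_sinhSeries_mul_split]
    exact Continuous.intervalIntegrable (by fun_prop) _ _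

lemma lintegral_hitProb_splitSeq {p : ℕ → ℝ} (hp : IsFinPartition p) {i : ℕ}
    (hi : i ∈ hp.parts) (k : ℕ) :
    ∫⁻ u in Set.Icc (0:ℝ) 1, hitProb k (_root_.splitSeq p i u) =
      ENNReal.ofReal (k.factorial / 2 * PowerSeries.coeff (k + 1)
        (splitSeries (p i) * ∏ l ∈ hp.parts.erase i, sinhSeries (p l))) := by
  rw [lintegral_congr_ae (hp.hitProb_splitSeq_ae hi k), ← ofReal_integral_eq_lintegral_ofReal]
  · rw [integral_Icc_eq_integral_Ioc, ← intervalIntegral.integral_of_le zero_le_one,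
      intervalIntegral.integral_const_mul, integral_coeff_split]
  · exact (continuous_const.mul (continuous_coeff_split _ _ _)).continuousOn.integrableOn_Icc
  · filter_upwards [ae_restrict_mem measurableSet_Icc] with u hu
    refine mul_nonneg (by positivity) (coeff_mul_nonneg (coeff_mul_nonneg
      (coeff_sinhSeries_nonneg (mul_nonneg hu.1 (hp.1 i)))
      (coeff_sinhSeries_nonneg (mul_nonneg (sub_nonneg.2 hu.2) (hp.1 i))))
      (coeff_prod_nonneg _ fun l _ => coeff_sinhSeries_nonneg (hp.1 l)) _)

lemma ccfOp_hitProb {p : ℕ → ℝ} (hp : IsFinPartition p) (k : ℕ) :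
    ccfOp (hitProb k) p = hitProb (k + 1) p := by
  have hterm : ∀ i ∈ hp.parts, ∀ j ∈ hp.parts,
      (if i ≠ j then ENNReal.ofReal (p i * p j) * hitProb k (_root_.mergeSeq p i j)
      else ENNReal.ofReal (p i ^ 2) *
        ∫⁻ u in Set.Icc (0:ℝ) 1, hitProb k (_root_.splitSeq p i u)) =
      ENNReal.ofReal (k.factorial / 2 *
        PowerSeries.coeff (k + 1) (pairSeries hp.parts p i j)) := by
    intro i hi j hj
    by_cases hij : i = j
    · subst hij
      rw [if_neg (by simp), hp.lintegral_hitProb_splitSeq hi,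
        ← ENNReal.ofReal_mul (by positivity), pairSeries, if_neg (by simp),
        PowerSeries.coeff_C_mul]
      congr 1
      ring
    · rw [if_pos hij, hitProb, if_pos (hp.mergeSeq hi hj hij), hp.hitValue_mergeSeq hi hj hij,
        ← ENNReal.ofReal_mul (mul_nonneg (hp.1 i) (hp.1 j)), pairSeries, if_pos hij,
        PowerSeries.coeff_C_mul]
      congr 1
      ring
  have hnn : ∀ i j, 0 ≤ (k.factorial : ℝ) / 2 *
      PowerSeries.coeff (k + 1) (pairSeries hp.parts p i j) := fun i j =>
    mul_nonneg (by positivity) (coeff_pairSeries_nonneg hp.1 _ _ _ _)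
  rw [hp.ccfOp_eq_sum, Finset.sum_congr rfl fun i hi => Finset.sum_congr rfl (hterm i hi)]
  simp only [← ENNReal.ofReal_sum_of_nonneg fun j (_ : j ∈ hp.parts) => hnn _ j]
  rw [← ENNReal.ofReal_sum_of_nonneg fun i _ => Finset.sum_nonneg fun j _ => hnn i j]
  simp only [← Finset.mul_sum]
  rw [coeff_sum_pairSeries _ _ hp.sum_parts, hitProb, if_pos hp, hitValue, hp.partitionSeries_eq,
    Nat.factorial_succ]
  congr 1
  push_cast
  ring

lemma hasSum {p : ℕ → ℝ} (hp : IsFinPartition p) : HasSum p 1 := by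
  rw [← hp.sum_parts]
  exact hasSum_sum_of_ne_finset_zero fun i hi => hp.eq_zero hi

lemma ccfOp_add {p : ℕ → ℝ} (hp : IsFinPartition p) (k : ℕ) (g : (ℕ → ℝ) → ℝ≥0∞) :
    ccfOp (hitProb k + g) p = ccfOp (hitProb k) p + ccfOp g p := by
  simp only [hp.ccfOp_eq_sum, ← Finset.sum_add_distrib]
  refine Finset.sum_congr rfl fun i hi => Finset.sum_congr rfl fun j _ => ?_
  split_ifs
  · rw [Pi.add_apply, mul_add]
  · simp only [Pi.add_apply]
    rw [lintegral_add_left', mul_add]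
    refine AEMeasurable.congr ?_ (hp.hitProb_splitSeq_ae hi k).symm
    refine (Measurable.ennreal_ofReal ?_).aemeasurable
    exact (continuous_const.mul (continuous_coeff_split _ _ _)).measurable

/-- A finite partition has `hitProb 0` equal to `1` or `0` according to whether it has one part. -/
lemma hitProb_zero {p : ℕ → ℝ} (hp : IsFinPartition p) :
    hitProb 0 p = if hp.parts.card = 1 then 1 else 0 := by
  rw [hitProb, if_pos hp, hitValue, hp.partitionSeries_eq]
  split_ifs with h
  · obtain ⟨i, hi⟩ := Finset.card_eq_one.1 h
    have h1 := hp.sum_parts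
    rw [hi] at h1 ⊢
    rw [Finset.sum_singleton] at h1
    rw [Finset.prod_singleton, h1, coeff_sinhSeries]
    norm_num
  · have hdvd : PowerSeries.X ^ hp.parts.card ∣ ∏ i ∈ hp.parts, sinhSeries (p i) := by
      rw [← Finset.prod_const]
      refine Finset.prod_dvd_prod_of_dvd _ _ fun i _ => ?_
      rw [PowerSeries.X_dvd_iff, ← PowerSeries.coeff_zero_eq_constantCoeff_apply, coeff_sinhSeries]
      simp
    have hpos : hp.parts.card ≠ 0 := by
      intro h0
      have := hp.sum_parts
      rw [Finset.card_eq_zero.1 h0] at this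
      simp at this
    rw [PowerSeries.X_pow_dvd_iff.1 hdvd (0 + 1) (by omega)]
    simp

end IsFinPartition

lemma hitProb_le_one (k : ℕ) : hitProb k ≤ 1 := by
  induction k with
  | zero =>
    intro p
    by_cases hp : IsFinPartition p
    · rw [hp.hitProb_zero]
      split_ifs <;> simp
    · simp [hitProb, hp]
  | succ k ih =>
    intro p
    by_cases hp : IsFinPartition p
    · rw [← hp.ccfOp_hitProb]
      exact (ccfOp_mono ih p).trans (ccfOp_one hp.1 hp.hasSum).le
    · simp [hitProb, hp]

lemma IsFinPartition.ccfOp_one_sub_hitProb {p : ℕ → ℝ} (hp : IsFinPartition p) (k : ℕ) :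
    ccfOp (1 - hitProb k) p = 1 - hitProb (k + 1) p := by
  have h : hitProb k + (1 - hitProb k) = 1 := add_tsub_cancel_of_le (hitProb_le_one k)
  have h1 := hp.ccfOp_add k (1 - hitProb k)
  rw [h, ccfOp_one hp.1 hp.hasSum, hp.ccfOp_hitProb] at h1
  rw [h1, ENNReal.add_sub_cancel_left]
  exact ne_top_of_le_ne_top ENNReal.one_ne_top (hitProb_le_one _ p)

/-- The trivial partition. -/
def trivialPartition : ℕ → ℝ := fun i => if i = 0 then (1:ℝ) else 0

lemma support_trivialPartition : Function.support trivialPartition = {0} := by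
  ext i
  simp [trivialPartition]

lemma isFinPartition_trivialPartition : IsFinPartition trivialPartition := by
  refine ⟨fun i => ?_, ?_, ?_⟩
  · rw [trivialPartition]; split_ifs <;> norm_num
  · rw [support_trivialPartition]; exact Set.finite_singleton 0
  · rw [finsum_eq_single _ 0 fun i hi => by simp [trivialPartition, hi]]
    simp [trivialPartition]

lemma hitProb_zero_of_mem_Omega1 {p : ℕ → ℝ} (hp : IsFinPartition p) (hO : p ∈ Omega1) :
    hitProb 0 p = ({trivialPartition} : Set (ℕ → ℝ)).indicator 1 p := by
  rw [hp.hitProb_zero]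
  by_cases h : p = trivialPartition
  · subst h
    have : hp.parts = {0} := by
      ext i; simp [IsFinPartition.parts, support_trivialPartition]
    simp [this]
  · rw [Set.indicator_of_notMem (by simpa using h), if_neg]
    intro hc
    obtain ⟨i, hi⟩ := Finset.card_eq_one.1 hc
    have hi' : i ∈ hp.parts := by simp [hi]
    have h1 := hp.sum_parts
    rw [hi, Finset.sum_singleton] at h1
    have h0 : 0 ∈ hp.parts := by
      by_contra hn
      have := hO.2.1 (Nat.zero_le i)
      rw [hp.eq_zero hn] at this
      linarith
    have hi0 : i = 0 := by
      rw [hi, Finset.mem_singleton] at h0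
      exact h0.symm
    subst hi0
    apply h
    funext j
    by_cases hj : j = 0
    · simp [hj, h1, trivialPartition]
    · rw [hp.eq_zero (by simp [hi, hj])]
      simp [trivialPartition, hj]

lemma hitProb_trivialPartition (k : ℕ) :
    hitProb k trivialPartition = ENNReal.ofReal ((1 - (-1) ^ (k + 1)) / (2 * (k + 1))) := by
  have hp := isFinPartition_trivialPartition
  have : hp.parts = {0} := by
    ext i; simp [IsFinPartition.parts, support_trivialPartition]
  rw [hitProb, if_pos hp, hitValue, hp.partitionSeries_eq, this, Finset.prod_singleton,
    coeff_sinhSeries, Nat.factorial_succ]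
  congr 1
  have : (k.factorial : ℝ) ≠ 0 := by positivity
  have : (k : ℝ) + 1 ≠ 0 := by positivity
  push_cast
  simp only [trivialPartition, if_true, one_pow]
  field_simp

/-! ### Measurability -/

/-- Partitions of `[0,1]` all of whose nonempty parts have index less than `M`. -/
def boundedPartitions (M : ℕ) : Set (ℕ → ℝ) :=
  {p | (∀ i, 0 ≤ p i) ∧ (∀ i, M ≤ i → p i = 0) ∧ ∑ i ∈ Finset.range M, p i = 1}

lemma measurableSet_boundedPartitions (M : ℕ) : MeasurableSet (boundedPartitions M) := by
  have : boundedPartitions M = (⋂ i, {p | 0 ≤ p i}) ∩ ((⋂ i, ⋂ _ : M ≤ i, {p | p i = 0}) ∩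
      {p | ∑ i ∈ Finset.range M, p i = 1}) := by
    ext p
    simp [boundedPartitions]
  rw [this]
  refine (MeasurableSet.iInter fun i => ?_).inter
    ((MeasurableSet.iInter fun i => MeasurableSet.iInter fun _ => ?_).inter ?_)
  · exact measurableSet_le measurable_const (measurable_pi_apply i)
  · exact measurableSet_eq_fun (measurable_pi_apply i) measurable_const
  · exact measurableSet_eq_fun
      (Finset.measurable_sum _ fun i _ => measurable_pi_apply i) measurable_const

lemma support_subset_range {p : ℕ → ℝ} {M : ℕ} (h : ∀ i, M ≤ i → p i = 0) :
    Function.support p ⊆ Finset.range M := by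
  intro i hi
  by_contra hn
  exact hi (h i (by simpa using hn))

lemma isFinPartition_of_mem_boundedPartitions {p : ℕ → ℝ} {M : ℕ}
    (hp : p ∈ boundedPartitions M) : IsFinPartition p := by
  have hs := support_subset_range hp.2.1
  exact ⟨hp.1, (Finset.finite_toSet _).subset hs,
    (finsum_eq_sum_of_support_subset _ hs).trans hp.2.2⟩

lemma IsFinPartition.exists_mem_boundedPartitions {p : ℕ → ℝ} (hp : IsFinPartition p) :
    ∃ M, p ∈ boundedPartitions M := by
  obtain ⟨M, hM⟩ := hp.2.1.bddAbove
  have h : ∀ i, M + 1 ≤ i → p i = 0 := by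
    intro i hi
    by_contra hn
    have := hM (Function.mem_support.2 hn)
    omega
  refine ⟨M + 1, hp.1, h, ?_⟩
  rw [← hp.2.2, finsum_eq_sum_of_support_subset _ (support_subset_range h)]

lemma measurableSet_isFinPartition : MeasurableSet {p : ℕ → ℝ | IsFinPartition p} := by
  have : {p : ℕ → ℝ | IsFinPartition p} = ⋃ M, boundedPartitions M := by
    ext p
    rw [Set.mem_iUnion]
    exact ⟨fun hp => hp.exists_mem_boundedPartitions,
      fun ⟨_, hM⟩ => isFinPartition_of_mem_boundedPartitions hM⟩
  rw [this]
  exact MeasurableSet.iUnion measurableSet_boundedPartitions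

lemma measurable_coeff_partSeries (n : ℕ) :
    Measurable fun a : ℝ => PowerSeries.coeff n (partSeries a) := by
  have : (fun a : ℝ => PowerSeries.coeff n (partSeries a)) = fun a => if a = 0 then
      PowerSeries.coeff n (1 : PowerSeries ℝ) else (a ^ n - (-a) ^ n) / n.factorial := by
    funext a
    rw [partSeries]
    split_ifs
    · rfl
    · exact coeff_sinhSeries a n
  rw [this]
  exact Measurable.ite (measurableSet_singleton 0) measurable_const (by fun_prop)

lemma measurable_coeff_prod_partSeries (M n : ℕ) :
    Measurable fun p : ℕ → ℝ =>
      PowerSeries.coeff n (∏ i ∈ Finset.range M, partSeries (p i)) := by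
  induction M generalizing n with
  | zero => simp
  | succ M ih =>
    simp only [Finset.prod_range_succ, PowerSeries.coeff_mul]
    exact Finset.measurable_sum _ fun i _ =>
      (ih _).mul ((measurable_coeff_partSeries _).comp (measurable_pi_apply M))

lemma measurable_hitProb (k : ℕ) : Measurable (hitProb k) := by
  have : hitProb k = fun p => ⨆ M, (boundedPartitions M).indicator (fun p => ENNReal.ofReal
      (k.factorial / 2 * PowerSeries.coeff (k + 1)
        (∏ i ∈ Finset.range M, partSeries (p i)))) p := by
    funext p
    have hval : ∀ M, p ∈ boundedPartitions M →
        partitionSeries p = ∏ i ∈ Finset.range M, partSeries (p i) := by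
      intro M hM
      rw [partitionSeries, finprod_eq_prod_of_mulSupport_subset]
      intro i hi
      refine support_subset_range hM.2.1 fun h => hi ?_
      simp only [h, partSeries_zero]
    by_cases hp : IsFinPartition p
    · rw [hitProb, if_pos hp]
      apply le_antisymm
      · obtain ⟨M, hM⟩ := hp.exists_mem_boundedPartitions
        refine le_trans ?_ (le_iSup _ M)
        rw [Set.indicator_of_mem hM, hitValue, hval M hM]
      · refine iSup_le fun M => Set.indicator_apply_le' (fun hM => ?_) fun _ => zero_le
        rw [hitValue, hval M hM]
    · rw [hitProb, if_neg hp]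
      refine (iSup_eq_bot.2 fun M => ?_).symm
      exact Set.indicator_of_notMem
        (fun hM => hp (isFinPartition_of_mem_boundedPartitions hM)) _
  rw [this]
  exact Measurable.iSup fun M => Measurable.indicator
    (measurable_const.mul (measurable_coeff_prod_partSeries M _)).ennreal_ofReal
    (measurableSet_boundedPartitions M)

lemma nullMeasurableSet_of_measure_add_measure_compl_le {Ω : Type*} [MeasurableSpace Ω]
    {P : Measure Ω} [IsFiniteMeasure P] {E : Set Ω} (h : P E + P Eᶜ ≤ P Set.univ) :
    NullMeasurableSet E P := by
  set t := toMeasurable P E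
  set t' := toMeasurable P Eᶜ
  have hu : t ∪ t' = Set.univ := by
    rw [Set.eq_univ_iff_forall]
    intro x
    by_cases hx : x ∈ E
    · exact Or.inl (subset_toMeasurable P E hx)
    · exact Or.inr (subset_toMeasurable P Eᶜ hx)
  have h1 := measure_union_add_inter (μ := P) t (measurableSet_toMeasurable P Eᶜ)
  change P (t ∪ t') + P (t ∩ t') = P t + P t' at h1
  rw [hu, measure_toMeasurable, measure_toMeasurable] at h1
  have h0 : P (t ∩ t') = 0 := by
    rw [← h1] at h
    have : P Set.univ + P (t ∩ t') ≤ P Set.univ + 0 := by simpa using h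
    simpa using (ENNReal.add_le_add_iff_left (measure_ne_top P _)).1 this
  refine (measurableSet_toMeasurable P E).nullMeasurableSet.congr ?_
  refine Filter.EventuallyLE.antisymm ?_ (subset_toMeasurable P E).eventuallyLE
  rw [ae_le_set]
  refine measure_mono_null ?_ h0
  exact fun x hx => ⟨hx.1, subset_toMeasurable P Eᶜ hx.2⟩

lemma nullMeasurableSet_of_filtrationTo {Ω S : Type*} [MeasurableSpace Ω] [MeasurableSpace S]
    {P : Measure Ω} {X : ℕ → Ω → S} (hX : ∀ k, NullMeasurable (X k) P) {k : ℕ} {B : Set Ω}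
    (hB : MeasurableSet[filtrationTo X k] B) : NullMeasurableSet B P := by
  have : filtrationTo X k ≤ (inferInstance : MeasurableSpace (NullMeasurableSpace Ω P)) :=
    iSup₂_le fun i _ => (hX i).measurable'.comap_le
  exact this B hB

lemma measurableSet_filtrationTo {Ω S : Type*} [MeasurableSpace S] (X : ℕ → Ω → S) {i k : ℕ}
    (hik : i ≤ k) {A : Set S} (hA : MeasurableSet A) :
    MeasurableSet[filtrationTo X k] (X i ⁻¹' A) := by
  have : MeasurableSpace.comap (X i) inferInstance ≤ filtrationTo X k :=
    le_iSup₂_of_le i (Finset.mem_range.2 (Nat.lt_succ_of_le hik)) le_rfl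
  exact this _ ⟨A, hA, rfl⟩

lemma filtrationTo_mono {Ω S : Type*} [MeasurableSpace S] (X : ℕ → Ω → S) {k l : ℕ}
    (hkl : k ≤ l) : filtrationTo X k ≤ filtrationTo X l :=
  iSup₂_le fun i hi => le_iSup₂_of_le i
    (Finset.mem_range.2 (by have := Finset.mem_range.1 hi; omega)) le_rfl

lemma hasSum_of_mem_Omega1 {p : ℕ → ℝ} (hp : p ∈ Omega1) : HasSum p 1 := by
  have hs : Summable p := by
    by_contra h
    have := hp.2.2
    rw [tsum_eq_zero_of_not_summable h] at this
    norm_num at this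
  exact hp.2.2 ▸ hs.hasSum

namespace IsCCFChain

lemma measure_inter_eq {Ω : Type*} [MeasurableSpace Ω] {P : Measure Ω} {X : ℕ → Ω → (ℕ → ℝ)}
    (hX : IsCCFChain P X) (k : ℕ) {A : Set (ℕ → ℝ)} (hA : MeasurableSet A) {B : Set Ω}
    (hB : MeasurableSet[filtrationTo X k] B) :
    P (B ∩ X (k + 1) ⁻¹' A) = ∫⁻ ω in B, ccfOp (A.indicator 1) (X k ω) ∂P :=
  hX.2 k A hA B hB

lemma measure_preimage_eq {Ω : Type*} [MeasurableSpace Ω] {P : Measure Ω}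
    {X : ℕ → Ω → (ℕ → ℝ)} (hX : IsCCFChain P X) (k : ℕ) {A : Set (ℕ → ℝ)}
    (hA : MeasurableSet A) :
    P (X (k + 1) ⁻¹' A) = ∫⁻ ω, ccfOp (A.indicator 1) (X k ω) ∂P := by
  have := hX.measure_inter_eq k hA (B := Set.univ) MeasurableSet.univ
  rwa [Set.univ_inter, Measure.restrict_univ] at this

lemma nullMeasurable {Ω : Type*} [MeasurableSpace Ω] {P : Measure Ω} [IsProbabilityMeasure P]
    {X : ℕ → Ω → (ℕ → ℝ)} (hX : IsCCFChain P X) (h0 : ∀ ω, X 0 ω = trivialPartition) (k : ℕ) :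
    NullMeasurable (X k) P := by
  cases k with
  | zero =>
    have : X 0 = fun _ => trivialPartition := funext h0
    rw [this]
    exact measurable_const.nullMeasurable
  | succ k =>
    intro A hA
    refine nullMeasurableSet_of_measure_add_measure_compl_le ?_
    rw [← Set.preimage_compl, hX.measure_preimage_eq k hA, hX.measure_preimage_eq k hA.compl]
    refine (le_lintegral_add _ _).trans ?_
    rw [← lintegral_one]
    refine lintegral_mono fun ω => ?_
    refine (ccfOp_add_le _ _ _).trans ?_
    rw [Set.indicator_self_add_compl, ccfOp_one (hX.1 k ω).1 (hasSum_of_mem_Omega1 (hX.1 k ω))]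

lemma ae_isFinPartition {Ω : Type*} [MeasurableSpace Ω] {P : Measure Ω}
    {X : ℕ → Ω → (ℕ → ℝ)} (hX : IsCCFChain P X) (h0 : ∀ ω, X 0 ω = trivialPartition) (k : ℕ) :
    ∀ᵐ ω ∂P, IsFinPartition (X k ω) := by
  induction k with
  | zero => exact Filter.Eventually.of_forall fun ω => h0 ω ▸ isFinPartition_trivialPartition
  | succ k ih =>
    change P (X (k + 1) ⁻¹' {p | IsFinPartition p}ᶜ) = 0
    have hno : ∀ q, IsFinPartition q →
        ({p | IsFinPartition p}ᶜ : Set (ℕ → ℝ)).indicator (1 : (ℕ → ℝ) → ℝ≥0∞) q = 0 :=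
      fun q hq => Set.indicator_of_notMem
        (Set.notMem_compl_iff.2 (show q ∈ {p | IsFinPartition p} from hq)) _
    rw [hX.measure_preimage_eq k measurableSet_isFinPartition.compl]
    rw [lintegral_congr_ae (g := 0), lintegral_zero_fun]
    filter_upwards [ih] with ω hp
    rw [hp.ccfOp_eq_sum]
    refine Finset.sum_eq_zero fun i hi => Finset.sum_eq_zero fun j hj => ?_
    split_ifs with hij
    · rw [hno _ (hp.mergeSeq hi hj hij), mul_zero]
    · rw [setLIntegral_congr_fun (g := 0) measurableSet_Icc fun u hu => ?_]
      · simp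
      · exact hno _ (hp.splitSeq hi hu)

lemma setLIntegral_succ_le {Ω : Type*} [MeasurableSpace Ω] {P : Measure Ω}
    {X : ℕ → Ω → (ℕ → ℝ)} (hX : IsCCFChain P X) (hm : ∀ k, NullMeasurable (X k) P) (k : ℕ)
    {B : Set Ω} (hB : MeasurableSet[filtrationTo X k] B) {f : (ℕ → ℝ) → ℝ≥0∞}
    (hf : Measurable f) :
    ∫⁻ ω in B, f (X (k + 1) ω) ∂P ≤ ∫⁻ ω in B, ccfOp f (X k ω) ∂P := by
  have hB0 := nullMeasurableSet_of_filtrationTo hm hB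
  have hY : AEMeasurable (X (k + 1)) (P.restrict B) := (hm (k + 1)).aemeasurable.restrict
  have key : ∫⁻ p, f p ∂((P.restrict B).map (X (k + 1))) ≤ ∫⁻ ω in B, ccfOp f (X k ω) ∂P := by
    refine Measurable.ennreal_induction
      (motive := fun f => ∫⁻ p, f p ∂((P.restrict B).map (X (k + 1))) ≤
        ∫⁻ ω in B, ccfOp f (X k ω) ∂P) ?_ ?_ ?_ hf
    · intro c A hA
      rw [lintegral_indicator_const hA, Measure.map_apply_of_aemeasurable hY hA,
        Measure.restrict_apply₀' hB0, Set.inter_comm, hX.measure_inter_eq k hA hB]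
      refine (lintegral_const_mul_le _ _).trans (lintegral_mono fun ω => ?_)
      refine (mul_ccfOp_le _ _ _).trans (ccfOp_mono (fun q => ?_) _)
      by_cases hq : q ∈ A <;> simp [hq]
    · intro f g _ hf _ ihf ihg
      simp only [Pi.add_apply]
      rw [lintegral_add_left hf]
      refine (add_le_add ihf ihg).trans ((le_lintegral_add _ _).trans (lintegral_mono fun ω => ?_))
      exact ccfOp_add_le f g _
    · intro f hf hmono ih
      rw [lintegral_iSup hf hmono]
      refine iSup_le fun n => (ih n).trans (lintegral_mono fun ω => ccfOp_mono (fun q => ?_) _)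
      exact le_iSup (fun n => f n q) n
  rwa [lintegral_map' hf.aemeasurable hY] at key

lemma setLIntegral_hitProb_succ {Ω : Type*} [MeasurableSpace Ω] {P : Measure Ω}
    [IsProbabilityMeasure P] {X : ℕ → Ω → (ℕ → ℝ)} (hX : IsCCFChain P X)
    (h0 : ∀ ω, X 0 ω = trivialPartition) (k j : ℕ) {B : Set Ω}
    (hB : MeasurableSet[filtrationTo X k] B) :
    ∫⁻ ω in B, hitProb j (X (k + 1) ω) ∂P = ∫⁻ ω in B, hitProb (j + 1) (X k ω) ∂P := by
  have hm := hX.nullMeasurable h0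
  have hfin := ae_restrict_of_ae (s := B) (hX.ae_isFinPartition h0 k)
  have hle := hX.setLIntegral_succ_le hm k hB (measurable_hitProb j)
  have hle' := hX.setLIntegral_succ_le hm k hB (measurable_one.sub (measurable_hitProb j))
  rw [lintegral_congr_ae (hfin.mono fun ω hω => hω.ccfOp_hitProb j)] at hle
  rw [lintegral_congr_ae (hfin.mono fun ω hω => hω.ccfOp_one_sub_hitProb j)] at hle'
  have hmeas : ∀ i l, AEMeasurable (fun ω => hitProb i (X l ω)) (P.restrict B) := fun i l =>
    (measurable_hitProb i).comp_aemeasurable (hm l).aemeasurable.restrict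
  have hsum : ∀ i l, ∫⁻ ω in B, hitProb i (X l ω) ∂P + ∫⁻ ω in B, (1 - hitProb i (X l ω)) ∂P
      = P B := by
    intro i l
    rw [← lintegral_add_left' (hmeas i l)]
    rw [← setLIntegral_one]
    exact lintegral_congr fun ω => add_tsub_cancel_of_le (hitProb_le_one i _)
  refine le_antisymm hle ?_
  have h1 := hsum j (k + 1)
  have h2 := hsum (j + 1) k
  have hfinite : ∫⁻ ω in B, (1 - hitProb (j + 1) (X k ω)) ∂P ≠ ∞ :=
    ne_top_of_le_ne_top (measure_ne_top P B) (h2 ▸ le_add_self)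
  refine (ENNReal.add_le_add_iff_right hfinite).1 ?_
  rw [h2, ← h1]
  exact add_le_add le_rfl hle'

lemma measure_inter_trivialPartition {Ω : Type*} [MeasurableSpace Ω] {P : Measure Ω}
    [IsProbabilityMeasure P] {X : ℕ → Ω → (ℕ → ℝ)} (hX : IsCCFChain P X)
    (h0 : ∀ ω, X 0 ω = trivialPartition) (j k : ℕ) {B : Set Ω}
    (hB : MeasurableSet[filtrationTo X k] B) :
    P (B ∩ X (k + j) ⁻¹' {trivialPartition}) = ∫⁻ ω in B, hitProb j (X k ω) ∂P := by
  induction j generalizing k with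
  | zero =>
    have hB0 := nullMeasurableSet_of_filtrationTo (hX.nullMeasurable h0) hB
    have hE := hX.nullMeasurable h0 k (measurableSet_singleton trivialPartition)
    have hfin := ae_restrict_of_ae (s := B) (hX.ae_isFinPartition h0 k)
    rw [lintegral_congr_ae (hfin.mono fun ω hω => hitProb_zero_of_mem_Omega1 hω (hX.1 k ω))]
    have : (fun ω => ({trivialPartition} : Set (ℕ → ℝ)).indicator (1 : (ℕ → ℝ) → ℝ≥0∞) (X k ω))
        = (X k ⁻¹' {trivialPartition}).indicator 1 := rfl
    rw [this, lintegral_indicator_one₀ (hE.mono_ac Measure.restrict_le_self.absolutelyContinuous),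
      Measure.restrict_apply₀' hB0, Set.inter_comm, add_zero]
  | succ j ih =>
    rw [← hX.setLIntegral_hitProb_succ h0 k j hB, ← ih (k + 1) (filtrationTo_mono X k.le_succ B hB),
      add_right_comm, add_assoc]

lemma measure_inter_trivialPartition_of_subset {Ω : Type*} [MeasurableSpace Ω] {P : Measure Ω}
    [IsProbabilityMeasure P] {X : ℕ → Ω → (ℕ → ℝ)} (hX : IsCCFChain P X)
    (h0 : ∀ ω, X 0 ω = trivialPartition) (j k : ℕ) {B : Set Ω}
    (hB : MeasurableSet[filtrationTo X k] B) (hsub : B ⊆ X k ⁻¹' {trivialPartition}) :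
    P (B ∩ X (k + j) ⁻¹' {trivialPartition}) = P B * hitProb j trivialPartition := by
  have hB0 := nullMeasurableSet_of_filtrationTo (hX.nullMeasurable h0) hB
  rw [hX.measure_inter_trivialPartition h0 j k hB, mul_comm, ← setLIntegral_const]
  refine lintegral_congr_ae ?_
  filter_upwards [ae_restrict_mem₀ hB0] with ω hω
  rw [show X k ω = trivialPartition from hsub hω]

end IsCCFChain

/-! ### Renewal argument -/

lemma tsum_hitProb_trivialPartition : ∑' k, hitProb k trivialPartition = ∞ := by
  by_contra h
  have hs := (ENNReal.summable_toReal h).comp_injective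
    (mul_right_injective₀ (two_ne_zero (α := ℕ)))
  have hs' : Summable fun k : ℕ => 2⁻¹ * (1 / ((k + 1 : ℕ) : ℝ)) := by
    refine Summable.of_nonneg_of_le (fun k => by positivity) (fun k => ?_) hs
    have hodd : ((-1 : ℝ)) ^ (2 * k + 1) = -1 := by
      rw [pow_succ, pow_mul]
      norm_num
    simp only [Function.comp_apply, hitProb_trivialPartition]
    rw [hodd, ENNReal.toReal_ofReal (by positivity)]
    push_cast
    rw [inv_mul_eq_div, div_div, div_le_div_iff₀ (by positivity) (by positivity)]
    have : (0 : ℝ) ≤ k := k.cast_nonneg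
    linarith
  have hs2 := (summable_mul_left_iff (inv_ne_zero (two_ne_zero (α := ℝ)))).1 hs'
  exact Real.not_summable_one_div_natCast
    ((summable_nat_add_iff (f := fun k : ℕ => 1 / (k : ℝ)) 1).1 hs2)

/-- The event that `E n` occurs but none of the next `m` events does. -/
def avoidSet {Ω : Type*} (E : ℕ → Set Ω) (n m : ℕ) : Set Ω :=
  E n ∩ ⋂ i ∈ Finset.range m, (E (n + i + 1))ᶜ

lemma avoidSet_zero {Ω : Type*} (E : ℕ → Set Ω) (n : ℕ) : avoidSet E n 0 = E n := by
  simp [avoidSet]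

lemma avoidSet_succ {Ω : Type*} (E : ℕ → Set Ω) (n m : ℕ) :
    avoidSet E n (m + 1) = avoidSet E n m \ E (n + m + 1) := by
  rw [avoidSet, Finset.range_add_one, Finset.set_biInter_insert, Set.inter_comm (E _)ᶜ,
    ← Set.inter_assoc, Set.sdiff_eq, avoidSet]

lemma measure_avoidSet_add {Ω : Type*} [MeasurableSpace Ω] {P : Measure Ω} {E : ℕ → Set Ω}
    (hE : ∀ k, NullMeasurableSet (E k) P) (n m : ℕ) :
    P (avoidSet E n m) + ∑ i ∈ Finset.range m, P (avoidSet E n i ∩ E (n + i + 1)) = P (E n) := by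
  induction m with
  | zero => simp [avoidSet_zero]
  | succ m ih =>
    rw [Finset.sum_range_succ, avoidSet_succ, add_comm (∑ i ∈ _, _), ← add_assoc,
      add_comm (P (_ \ _)), measure_inter_add_sdiff₀ _ (hE _), ih]

lemma inter_subset_iUnion_avoidSet {Ω : Type*} (E : ℕ → Set Ω) (n j : ℕ) :
    E n ∩ E (n + (j + 1)) ⊆
      ⋃ m ∈ Finset.range (j + 1), avoidSet E n m ∩ E (n + m + 1) ∩ E (n + m + 1 + (j - m)) := by
  classical
  rintro ω ⟨hn, hj⟩
  have hex : ∃ m, ω ∈ E (n + m + 1) := ⟨j, hj⟩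
  have hle : Nat.find hex ≤ j := Nat.find_min' hex hj
  refine Set.mem_biUnion (x := Nat.find hex) (by simpa [Nat.lt_succ_iff] using hle) ?_
  refine ⟨⟨⟨hn, ?_⟩, Nat.find_spec hex⟩, ?_⟩
  · refine Set.mem_iInter₂.2 fun i hi => Nat.find_min hex (Finset.mem_range.1 hi)
  · rw [show n + Nat.find hex + 1 + (j - Nat.find hex) = n + (j + 1) by omega]
    exact hj

/-- If the events `E k` form a renewal sequence whose renewal probabilities have infinite sum,
then almost surely `E n` is followed by a later `E m`. -/
lemma measure_noReturn_eq_zero {Ω : Type*} [MeasurableSpace Ω] {P : Measure Ω}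
    [IsProbabilityMeasure P] {E : ℕ → Set Ω} (hE : ∀ k, NullMeasurableSet (E k) P)
    {c : ℕ → ℝ≥0∞} (hc : ∀ k, c k ≤ 1) (hsum : ∑' k, c k = ∞) (n : ℕ)
    (hn : ∀ j, P (E n ∩ E (n + j)) = P (E n) * c j)
    (hren : ∀ m j, P (avoidSet E n m ∩ E (n + m + 1) ∩ E (n + m + 1 + j)) =
      P (avoidSet E n m ∩ E (n + m + 1)) * c j) :
    P (E n ∩ ⋂ i, (E (n + i + 1))ᶜ) = 0 := by
  set b := P (E n)
  set l := P (E n ∩ ⋂ i, (E (n + i + 1))ᶜ)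
  set r : ℕ → ℝ≥0∞ := fun m => P (avoidSet E n m ∩ E (n + m + 1))
  have hrec : ∀ j, b * c (j + 1) ≤ ∑ m ∈ Finset.range (j + 1), r m * c (j - m) := by
    intro j
    rw [← hn]
    refine (measure_mono (inter_subset_iUnion_avoidSet E n j)).trans ?_
    refine (measure_biUnion_finset_le _ _).trans (Finset.sum_le_sum fun m _ => ?_)
    exact (hren m _).le
  have hl : ∀ J, l + ∑ m ∈ Finset.range J, r m ≤ b := by
    intro J
    refine le_of_le_of_eq (add_le_add_left ?_ _) (measure_avoidSet_add hE n J)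
    exact measure_mono (Set.inter_subset_inter_right _ fun ω hω =>
      Set.mem_iInter₂.2 fun i _ => Set.mem_iInter.1 hω i)
  have hbound : ∀ J, l * ∑ i ∈ Finset.range J, c i ≤ 1 := by
    intro J
    set A := ∑ i ∈ Finset.range J, c i
    have hAtop : A ≠ ∞ := ENNReal.sum_ne_top.2 fun i _ => ne_top_of_le_ne_top one_ne_top (hc i)
    have hbA : b * A ≠ ∞ := ENNReal.mul_ne_top (measure_ne_top P _) hAtop
    have hconv : b * A ≤ 1 + (∑ m ∈ Finset.range J, r m) * A := by
      have hA : A ≤ ∑ i ∈ Finset.range J, c (i + 1) + c 0 := by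
        rw [← Finset.sum_range_succ']
        exact Finset.sum_le_sum_of_subset (Finset.range_mono J.le_succ)
      calc b * A ≤ b * (∑ i ∈ Finset.range J, c (i + 1) + c 0) := by gcongr
        _ = ∑ j ∈ Finset.range J, b * c (j + 1) + b * c 0 := by rw [mul_add, Finset.mul_sum]
        _ ≤ ∑ j ∈ Finset.range J, ∑ m ∈ Finset.range (j + 1), r m * c (j - m) + 1 := by
          refine add_le_add (Finset.sum_le_sum fun j _ => hrec j) ?_
          exact mul_le_one' prob_le_one (hc 0)
        _ ≤ (∑ m ∈ Finset.range J, r m) * A + 1 := by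
          gcongr
          rw [Finset.sum_comm' (t' := Finset.range J) (s' := fun m => Finset.Ico m J)
            (by simp only [Finset.mem_range, Finset.mem_Ico]; omega), Finset.sum_mul]
          refine Finset.sum_le_sum fun m _ => ?_
          rw [← Finset.mul_sum, Finset.sum_Ico_eq_sum_range]
          simp only [Nat.add_sub_cancel_left]
          gcongr
          exact Finset.sum_le_sum_of_subset (Finset.range_mono (J.sub_le m))
        _ = _ := add_comm _ _
    have h2 : b * A + l * A ≤ b * A + 1 :=
      calc b * A + l * A ≤ 1 + (∑ m ∈ Finset.range J, r m) * A + l * A := by gcongr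
        _ = (l + ∑ m ∈ Finset.range J, r m) * A + 1 := by ring
        _ ≤ b * A + 1 := by
          gcongr
          exact hl J
    exact (ENNReal.add_le_add_iff_left hbA).1 h2
  by_contra hne
  have : l * ∑' k, c k ≤ 1 := by
    rw [ENNReal.tsum_eq_iSup_nat, ENNReal.mul_iSup]
    exact iSup_le hbound
  rw [hsum, ENNReal.mul_top hne] at this
  exact absurd this (by simp)

lemma infinite_of_forall_exists_later {S : Set ℕ} (h0 : 0 ∈ S)
    (h : ∀ n ∈ S, ∃ i, n + i + 1 ∈ S) : {k | 1 ≤ k ∧ k ∈ S}.Infinite := by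
  refine Set.infinite_of_not_bddAbove fun ⟨M, hM⟩ => ?_
  have key : ∀ m, ∃ n ∈ S, m ≤ n := by
    intro m
    induction m with
    | zero => exact ⟨0, h0, le_rfl⟩
    | succ m ih =>
      obtain ⟨n, hn, hmn⟩ := ih
      obtain ⟨i, hi⟩ := h n hn
      exact ⟨n + i + 1, hi, by omega⟩
  obtain ⟨n, hn, hle⟩ := key (M + 1)
  have := hM ⟨by omega, hn⟩
  omega

lemma measurableSet_filtrationTo_avoidSet {Ω S : Type*} [MeasurableSpace S] (X : ℕ → Ω → S)
    {A : Set S} (hA : MeasurableSet A) (n m : ℕ) :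
    MeasurableSet[filtrationTo X (n + m)] (avoidSet (fun k => X k ⁻¹' A) n m) := by
  refine MeasurableSet.inter (measurableSet_filtrationTo X (by omega) hA) ?_
  refine Finset.measurableSet_biInter _ fun i hi => MeasurableSet.compl ?_
  exact measurableSet_filtrationTo X (by have := Finset.mem_range.1 hi; omega) hA

lemma IsCCFChain.ae_infinite_trivialPartition {Ω : Type*} [MeasurableSpace Ω] {P : Measure Ω}
    [IsProbabilityMeasure P] {X : ℕ → Ω → (ℕ → ℝ)} (hX : IsCCFChain P X)
    (h0 : ∀ ω, X 0 ω = trivialPartition) :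
    ∀ᵐ ω ∂P, {k : ℕ | 1 ≤ k ∧ X k ω = trivialPartition}.Infinite := by
  set E : ℕ → Set Ω := fun k => X k ⁻¹' {trivialPartition}
  have hs : MeasurableSet ({trivialPartition} : Set (ℕ → ℝ)) := measurableSet_singleton _
  have hzero : ∀ n, P (E n ∩ ⋂ i, (E (n + i + 1))ᶜ) = 0 := by
    intro n
    refine measure_noReturn_eq_zero (fun k => hX.nullMeasurable h0 k hs)
      (fun k => hitProb_le_one k _) tsum_hitProb_trivialPartition n (fun j => ?_) (fun m j => ?_)
    · exact hX.measure_inter_trivialPartition_of_subset h0 j n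
        (measurableSet_filtrationTo X le_rfl hs) subset_rfl
    · refine hX.measure_inter_trivialPartition_of_subset h0 j (n + m + 1) ?_
        Set.inter_subset_right
      exact MeasurableSet.inter
        (filtrationTo_mono X (Nat.le_succ _) _ (measurableSet_filtrationTo_avoidSet X hs n m))
        (measurableSet_filtrationTo X le_rfl hs)
  filter_upwards [ae_all_iff.2 fun n => measure_eq_zero_iff_ae_notMem.1 (hzero n)] with ω hω
  refine infinite_of_forall_exists_later (S := {k | X k ω = trivialPartition}) (h0 ω)
    fun n hn => ?_
  by_contra! hno
  exact hω n ⟨hn, Set.mem_iInter.2 hno⟩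

/-- **Recurrence of the trivial partition for the CCF** (note added in proof):
the state `s = (1, 0, 0, …)` is recurrent: a CCF chain started at `s` almost
surely returns to `s` at some time `k ≥ 1`, and in fact visits `s` at
infinitely many times. -/
theorem ccf_recurrence_trivial_state (Ω : Type) [MeasurableSpace Ω]
    (P : Measure Ω) (hP : IsProbabilityMeasure P)
    (X : ℕ → Ω → (ℕ → ℝ)) (hX : IsCCFChain P X)
    (h0 : ∀ ω, X 0 ω = fun i => if i = 0 then (1:ℝ) else 0) :
    ∀ᵐ ω ∂P,
      (∃ k : ℕ, 1 ≤ k ∧ X k ω = fun i => if i = 0 then (1:ℝ) else 0) ∧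
      {k : ℕ | 1 ≤ k ∧ X k ω = fun i => if i = 0 then (1:ℝ) else 0}.Infinite := by
  filter_upwards [hX.ae_infinite_trivialPartition h0] with ω hω
  exact ⟨hω.nonempty, hω⟩

end
end
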